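/- Let (u,m) be the classical solution of the MFG system (so that m>0 on Q). Then any classical solution (v,ρ) of the linearized system (i) -∂_t v - Δv + H_p(x,m,Du)·Dv + H_m(x,m,Du)ρ = f'(m)ρ in Q, (ii) ∂_t ρ - Δρ - div(ρ·H_p(x,m,Du)) - div(m·ρ·H_{pm}(x,m,Du)) = div(m·H_{pp}(x,m,Du)Dv) in Q, with ρ(x,0)=0 and v(x,T)=0 on 𝕋^d, is the trivial solution (v,ρ)=(0,0). -/

import Mathlib

open Set MeasureTheory
open scoped RealInnerProductSpace

noncomputable section

/-- Euclidean space ℝ^d, used as the universal cover of the flat torus 𝕋^d. -/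
abbrev Ed (d : ℕ) : Type := EuclideanSpace ℝ (Fin d)

variable {d : ℕ}

/-- The `i`-th unit coordinate vector of ℝ^d. -/
def ebasis (d : ℕ) (i : Fin d) : Ed d := EuclideanSpace.single i 1

/-- Second spatial partial derivative `∂²f/∂xᵢ∂xⱼ`. -/
def partial2 (f : Ed d → ℝ) (i j : Fin d) (x : Ed d) : ℝ :=
  fderiv ℝ (fun y => fderiv ℝ f y (ebasis d j)) x (ebasis d i)

/-- Laplacian in the space variable. -/
def lap (f : Ed d → ℝ) (x : Ed d) : ℝ := ∑ i, partial2 f i i x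

/-- Divergence of a vector field in the space variable. -/
def diverg (F : Ed d → Ed d) (x : Ed d) : ℝ :=
  ∑ i, ⟪fderiv ℝ F x (ebasis d i), ebasis d i⟫

/-- Spatial gradient. -/
def sgrad (f : Ed d → ℝ) (x : Ed d) : Ed d := gradient f x

/-- ℤ^d-periodicity: a function on ℝ^d descending to the flat torus 𝕋^d. -/
def ZPeriodic (f : Ed d → ℝ) : Prop :=
  ∀ (x : Ed d) (i : Fin d), f (x + ebasis d i) = f x

/-- Time derivative within the time interval `[0,T]`. -/
def tderiv (T : ℝ) (w : ℝ → Ed d → ℝ) (t : ℝ) (x : Ed d) : ℝ :=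
  derivWithin (fun s => w s x) (Icc 0 T) t

/-- `w` is bounded and parabolically `a`-Hölder on `Q = 𝕋^d × [0,T]`. -/
def HolderBddQ (T a : ℝ) (w : ℝ → Ed d → ℝ) : Prop :=
  ∃ C : ℝ, (∀ t ∈ Icc (0:ℝ) T, ∀ x : Ed d, |w t x| ≤ C) ∧
    ∀ t ∈ Icc (0:ℝ) T, ∀ s ∈ Icc (0:ℝ) T, ∀ x y : Ed d,
      |w t x - w s y| ≤ C * (‖x - y‖ ^ 2 + |t - s|) ^ (a / 2)

/-- Membership in the parabolic Hölder space `C^{2+a,1+a/2}(Q)` (including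
ℤ^d-periodicity in the space variable): `w` is C² in space, differentiable in
time, and `w`, `Dw`, `D²w`, `∂ₜw` are bounded and parabolically Hölder. -/
def InC2alpha (T a : ℝ) (w : ℝ → Ed d → ℝ) : Prop :=
  (∀ t ∈ Icc (0:ℝ) T, ZPeriodic (w t)) ∧
  (∀ t ∈ Icc (0:ℝ) T, ContDiff ℝ 2 (w t)) ∧
  (∀ x : Ed d, DifferentiableOn ℝ (fun s => w s x) (Icc 0 T)) ∧
  HolderBddQ T a w ∧
  (∀ i : Fin d, HolderBddQ T a fun t x => ⟪sgrad (w t) x, ebasis d i⟫) ∧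
  (∀ i j : Fin d, HolderBddQ T a fun t x => partial2 (w t) i j x) ∧
  HolderBddQ T a fun t x => tderiv T w t x

/-- Membership in `C^{2+a}(𝕋^d)` for time-independent functions. -/
def InC2alphaSpace (a : ℝ) (g : Ed d → ℝ) : Prop :=
  ZPeriodic g ∧ ContDiff ℝ 2 g ∧
  ∃ C : ℝ, ∀ (i j : Fin d) (x y : Ed d),
    |partial2 g i j x - partial2 g i j y| ≤ C * ‖x - y‖ ^ a

/-- The fundamental domain `[0,1)^d` of the torus, used for integration. -/
def cube (d : ℕ) : Set (Ed d) := {x : Ed d | ∀ i, x i ∈ Ico (0:ℝ) 1}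

/-- `H_p`: gradient of `H = H(x,m,p)` in `p`. -/
def HamP (H : Ed d → ℝ → Ed d → ℝ) (x : Ed d) (m : ℝ) (p : Ed d) : Ed d :=
  gradient (H x m) p

/-- `H_m`: derivative of `H = H(x,m,p)` in `m`. -/
def HamM (H : Ed d → ℝ → Ed d → ℝ) (x : Ed d) (m : ℝ) (p : Ed d) : ℝ :=
  deriv (fun s => H x s p) m

/-- `H_pm`: gradient in `p` of `H_m`. -/
def HamPM (H : Ed d → ℝ → Ed d → ℝ) (x : Ed d) (m : ℝ) (p : Ed d) : Ed d :=
  gradient (fun q => HamM H x m q) p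

/-- `H_pp`: Hessian of `H` in `p`, as a continuous linear map. -/
def HamPP (H : Ed d → ℝ → Ed d → ℝ) (x : Ed d) (m : ℝ) (p : Ed d) :
    Ed d →L[ℝ] Ed d :=
  fderiv ℝ (fun q => HamP H x m q) p

/-- `H_mm`: second derivative of `H` in `m`. -/
def HamMM (H : Ed d → ℝ → Ed d → ℝ) (x : Ed d) (m : ℝ) (p : Ed d) : ℝ :=
  deriv (fun s => HamM H x s p) m

/-- Assumption (A1): `m₀ ∈ C^{2+a}(𝕋^d)` is a probability density with
`m₀ ≥ ϑ > 0`, and `u_T ∈ C^{2+a}(𝕋^d)`. -/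
def A1 (a ϑ : ℝ) (m0 uT : Ed d → ℝ) : Prop :=
  InC2alphaSpace a m0 ∧ InC2alphaSpace a uT ∧ (∀ x, ϑ ≤ m0 x) ∧
  (∫ x in cube d, m0 x) = 1

/-- Assumption (A2): `H ∈ C⁴(𝕋^d × (0,∞) × ℝ^d)`, the growth bounds
`|H_px| ≤ C̄(|p|+1)`, `|H_xx| + |H_xxm| ≤ C̄(|p|²+1)`, `|H_mp| ≤ C̄|p|`,
`|H_mm| ≤ C̄|p|²`, `|H_pp| + |H_ppm| ≤ C̄`, `|H_ppp| + |H_pppm| ≤ C̄`, and the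
Hessian-type monotonicity condition: for every `m > 0` the block matrix
`[[-H_m, (m/2)H_pmᵀ],[(m/2)H_pm, m·H_pp]]` is positive definite, expressed via
its quadratic form on `(r,q) ∈ ℝ × ℝ^d`. -/
def A2 (H : Ed d → ℝ → Ed d → ℝ) : Prop :=
  ContDiffOn ℝ 4 (fun q : Ed d × ℝ × Ed d => H q.1 q.2.1 q.2.2)
    {q : Ed d × ℝ × Ed d | 0 < q.2.1} ∧
  (∃ Cb : ℝ, 0 < Cb ∧ ∀ (x : Ed d) (m : ℝ), 0 < m → ∀ p : Ed d,
    ‖fderiv ℝ (fun y => HamP H y m p) x‖ ≤ Cb * (‖p‖ + 1) ∧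
    ‖iteratedFDeriv ℝ 2 (fun y => H y m p) x‖ +
        ‖iteratedFDeriv ℝ 2 (fun y => HamM H y m p) x‖ ≤ Cb * (‖p‖ ^ 2 + 1) ∧
    ‖HamPM H x m p‖ ≤ Cb * ‖p‖ ∧
    |HamMM H x m p| ≤ Cb * ‖p‖ ^ 2 ∧
    ‖HamPP H x m p‖ + ‖fderiv ℝ (fun q => HamPM H x m q) p‖ ≤ Cb ∧
    ‖iteratedFDeriv ℝ 3 (fun q => H x m q) p‖ +
        ‖iteratedFDeriv ℝ 3 (fun q => HamM H x m q) p‖ ≤ Cb) ∧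
  (∀ (x : Ed d) (m : ℝ), 0 < m → ∀ p : Ed d, ∀ (r : ℝ) (q : Ed d),
    ¬(r = 0 ∧ q = 0) →
    0 < -HamM H x m p * r ^ 2 + m * ⟪HamPM H x m p, q⟫ * r +
        m * ⟪HamPP H x m p q, q⟫)

/-- Assumption (A3): `f ∈ C²((0,∞))` with `f, f', f''` uniformly bounded and
`f' ≥ 0`. -/
def A3 (f : ℝ → ℝ) : Prop :=
  ContDiffOn ℝ 2 f (Ioi 0) ∧
  (∃ C : ℝ, ∀ m : ℝ, 0 < m →
    |f m| ≤ C ∧ |deriv f m| ≤ C ∧ |deriv (deriv f) m| ≤ C) ∧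
  (∀ m : ℝ, 0 < m → 0 ≤ deriv f m)

/-- The MFG system with non-separable Hamiltonian and local coupling,
satisfied pointwise on `Q = 𝕋^d × [0,T]`:
(i)  `-∂ₜu - Δu + H(x,m,Du) = f(m)`;
(ii) `∂ₜm - Δm - div(m·H_p(x,m,Du)) = 0`;
with `m(·,0) = m₀` and `u(·,T) = u_T`. -/
def SolvesMFG (T : ℝ) (H : Ed d → ℝ → Ed d → ℝ) (f : ℝ → ℝ)
    (m0 uT : Ed d → ℝ) (u m : ℝ → Ed d → ℝ) : Prop :=
  (∀ t ∈ Icc (0:ℝ) T, ∀ x : Ed d,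
    -tderiv T u t x - lap (u t) x + H x (m t x) (sgrad (u t) x) = f (m t x)) ∧
  (∀ t ∈ Icc (0:ℝ) T, ∀ x : Ed d,
    tderiv T m t x - lap (m t) x -
      diverg (fun y => m t y • HamP H y (m t y) (sgrad (u t) y)) x = 0) ∧
  (∀ x : Ed d, m 0 x = m0 x) ∧ (∀ x : Ed d, u T x = uT x)

/-- The standard integer lattice. -/
abbrev lat (d : ℕ) : Submodule ℤ (Ed d) :=
  Submodule.span ℤ (Set.range (EuclideanSpace.basisFun (Fin d) ℝ).toBasis)

lemma cube_eq : cube d = ZSpan.fundamentalDomain (EuclideanSpace.basisFun (Fin d) ℝ).toBasis := by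
  ext x
  simp [cube, ZSpan.mem_fundamentalDomain]

lemma cube_fd : IsAddFundamentalDomain (lat d) (cube d) volume := by
  rw [cube_eq]
  exact ZSpan.isAddFundamentalDomain _ _

lemma cube_meas : MeasurableSet (cube d) := by
  rw [cube_eq]
  exact ZSpan.fundamentalDomain_measurableSet _

lemma cube_vol : volume (cube d) = 1 := by
  rw [cube_eq, measure_congr (ZSpan.fundamentalDomain_ae_parallelepiped _ _)]
  have := (EuclideanSpace.basisFun (Fin d) ℝ).volume_parallelepiped
  simpa using this

lemma cube_bdd : ∃ K : ℝ, 0 < K ∧ ∀ y ∈ cube d, ‖y‖ ≤ K := by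
  have h : Bornology.IsBounded (cube d) := by
    rw [cube_eq]
    exact ZSpan.fundamentalDomain_isBounded _
  obtain ⟨K, hK, h2⟩ := h.exists_pos_norm_le
  exact ⟨K, hK, h2⟩

lemma per_lat {X : Type*} {g : Ed d → X} (hg : ∀ (x : Ed d) (i : Fin d), g (x + ebasis d i) = g x)
    {k : Ed d} (hk : k ∈ lat d) : ∀ x, g (x + k) = g x := by
  induction hk using Submodule.span_induction with
  | mem y hy =>
    obtain ⟨i, rfl⟩ := hy
    intro x
    have := hg x i
    simpa [ebasis] using this
  | zero => simp
  | add a b _ _ ha hb => intro x; rw [← add_assoc, hb, ha]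
  | smul n a _ ha =>
    intro x
    have hneg : ∀ x, g (x - a) = g x := fun x => by
      have := ha (x - a); rw [sub_add_cancel] at this; exact this.symm
    induction n using Int.induction_on generalizing x with
    | zero => simp
    | succ n ih => rw [add_smul, one_smul, ← add_assoc, ha, ih]
    | pred n ih => rw [sub_smul, one_smul, ← add_sub_assoc, hneg, ih]

lemma lat_inv : VAddInvariantMeasure (lat d) (Ed d) volume :=
  ⟨fun c s _ => measure_preimage_add volume (c : Ed d) s⟩

open scoped Pointwise in
lemma cube_translate {g : Ed d → ℝ} (hg : ZPeriodic g) (x : Ed d) :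
    ∫ y in cube d, g (x + y) = ∫ y in cube d, g y := by
  have h1 : ∫ y in x +ᵥ cube d, g y = ∫ y in cube d, g y := by
    have : VAddInvariantMeasure (lat d) (Ed d) volume := lat_inv
    refine (cube_fd.vadd_of_comm x).setIntegral_eq cube_fd ?_
    intro k y
    have := per_lat hg k.2 y
    rw [add_comm] at this
    exact this
  rw [← h1]
  have := (measurePreserving_add_left (volume : Measure (Ed d)) x).setIntegral_preimage_emb
    (measurableEmbedding_addLeft x) g (x +ᵥ cube d)
  rw [← this]
  congr 2
  ext y
  simp [Set.mem_vadd_set]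

/-- every point is a lattice translate of a point of the cube -/
lemma exists_cube (x : Ed d) : ∃ k ∈ lat d, x - k ∈ cube d := by
  refine ⟨ZSpan.floor (EuclideanSpace.basisFun (Fin d) ℝ).toBasis x, Subtype.mem _, ?_⟩
  rw [cube_eq]
  exact ZSpan.fract_mem_fundamentalDomain _ x

lemma averaging {G g : Ed d → ℝ} (hG : Continuous G) {Lp R M K : ℝ} (hLp : 0 ≤ Lp)
    (hK : ∀ y ∈ cube d, ‖y‖ ≤ K) (hK0 : 0 ≤ K)
    (hLip : ∀ x y, |G x - G y| ≤ Lp * ‖x - y‖) (hR : ∀ x, R < ‖x‖ → G x = 0)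
    (hg : ZPeriodic g) (hgm : Measurable g) (hM : ∀ x, |g x| ≤ M) :
    |(∫ x, G x * g x) - (∫ x, G x) * ∫ x in cube d, g x| ≤
      Lp * K * M * volume.real (Metric.closedBall (0 : Ed d) (R + K)) := by
  have hM0 : 0 ≤ M := (abs_nonneg _).trans (hM 0)
  have hcs : HasCompactSupport G := by
    refine HasCompactSupport.intro (isCompact_closedBall (0 : Ed d) R) ?_
    intro x hx
    apply hR
    simpa using hx
  have hGi : Integrable G := hG.integrable_of_hasCompactSupport hcs
  have hGg : ∀ h : Ed d → ℝ, Measurable h → (∀ x, |h x| ≤ M) →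
      Integrable (fun x => G x * h x) := by
    intro h h1 h2
    exact hGi.mul_bdd (c := M) h1.aestronglyMeasurable (Filter.Eventually.of_forall h2)
  have : IsFiniteMeasure (volume.restrict (cube d)) := ⟨by simp [cube_vol]⟩
  have hv1 : volume.real (cube d) = 1 := by simp [measureReal_def, cube_vol]
  have e1 : (∫ x, G x * g x) = ∫ y in cube d, ∫ x, G (x + y) * g (x + y) := by
    have : ∀ y : Ed d, ∫ x, G (x + y) * g (x + y) = ∫ x, G x * g x := fun y =>
      integral_add_right_eq_self (fun x => G x * g x) y
    simp_rw [this]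
    simp [hv1]
  have hprod : Integrable (Function.uncurry fun x y : Ed d => G x * g (x + y))
      (volume.prod (volume.restrict (cube d))) := by
    have h0 : Integrable (fun z : Ed d × Ed d => G z.1) (volume.prod (volume.restrict (cube d))) :=
      hGi.comp_fst _
    refine h0.mul_bdd (c := M) (g := fun z => g (z.1 + z.2)) ?_ (Filter.Eventually.of_forall fun z => hM _)
    exact (hgm.comp (measurable_fst.add measurable_snd)).aestronglyMeasurable
  have e2 : (∫ x, G x) * ∫ x in cube d, g x = ∫ y in cube d, ∫ x, G x * g (x + y) := by
    rw [← integral_integral_swap hprod, ← integral_mul_const]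
    congr 1
    ext x
    rw [integral_const_mul, cube_translate hg]
  have i1 : Integrable (fun y => ∫ x, G x * g (x + y)) (volume.restrict (cube d)) :=
    hprod.integral_prod_right
  have i0 : Integrable (fun y => ∫ x, G (x + y) * g (x + y)) (volume.restrict (cube d)) := by
    have : ∀ y : Ed d, ∫ x, G (x + y) * g (x + y) = ∫ x, G x * g x := fun y =>
      integral_add_right_eq_self (fun x => G x * g x) y
    simp_rw [this]
    exact integrable_const _
  rw [e1, e2, ← integral_sub i0 i1]
  set Vb := volume.real (Metric.closedBall (0 : Ed d) (R + K))
  have key : ∀ y ∈ cube d, ‖(∫ x, G (x + y) * g (x + y)) - ∫ x, G x * g (x + y)‖ ≤ Lp * K * M * Vb := by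
    intro y hy
    have hgm' : Measurable fun x => g (x + y) := hgm.comp (measurable_id.add_const y)
    have j1 : Integrable fun x => G (x + y) * g (x + y) :=
      (hGg g hgm hM).comp_add_right y
    rw [← integral_sub j1 (hGg _ hgm' fun x => hM _)]
    have hz : ∀ x, x ∉ Metric.closedBall (0 : Ed d) (R + K) →
        G (x + y) * g (x + y) - G x * g (x + y) = 0 := by
      intro x hx
      have hx' : R + K < ‖x‖ := by simpa using hx
      have a1 : G x = 0 := hR x (by linarith)
      have a2 : G (x + y) = 0 := hR _ (by
        have := norm_sub_le (x + y) y
        simp only [add_sub_cancel_right] at this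
        have := hK y hy
        linarith)
      rw [a1, a2]; ring
    rw [← setIntegral_eq_integral_of_forall_compl_eq_zero hz]
    refine norm_setIntegral_le_of_norm_le_const
      (isCompact_closedBall (0 : Ed d) (R + K)).measure_lt_top ?_
    intro x _
    rw [← sub_mul, norm_mul]
    refine mul_le_mul ?_ (hM _) (norm_nonneg _) (by positivity)
    refine (hLip (x + y) x).trans ?_
    simp only [add_sub_cancel_left]
    exact mul_le_mul_of_nonneg_left (hK y hy) hLp
  have := norm_setIntegral_le_of_norm_le_const (μ := volume) (s := cube d) (by simp [cube_vol]) key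
  rw [hv1, mul_one] at this
  exact this

lemma exists_bump (d : ℕ) : ∃ φ : Ed d → ℝ, ContDiff ℝ 2 φ ∧ (∀ x, 0 ≤ φ x) ∧
    (∀ x, 1 < ‖x‖ → φ x = 0) ∧ 0 < (∫ x, φ x) ∧ ∃ A : ℝ, 0 < A ∧
      (∀ x, ‖fderiv ℝ φ x‖ ≤ A) ∧ ∀ x y, ‖fderiv ℝ φ x - fderiv ℝ φ y‖ ≤ A * ‖x - y‖ := by
  let b : ContDiffBump (0 : Ed d) := ⟨1/2, 1, by norm_num, by norm_num⟩
  have hb : ContDiff ℝ 2 (b : Ed d → ℝ) := b.contDiff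
  have hcs : HasCompactSupport (fderiv ℝ (b : Ed d → ℝ)) := b.hasCompactSupport.fderiv ℝ
  have h1 : ContDiff ℝ 1 (fderiv ℝ (b : Ed d → ℝ)) := hb.fderiv_right (by norm_num)
  obtain ⟨K, hK⟩ := h1.lipschitzWith_of_hasCompactSupport hcs (by norm_num)
  obtain ⟨A, hA⟩ := hcs.exists_bound_of_continuous h1.continuous
  refine ⟨b, hb, fun x => b.nonneg, ?_, b.integral_pos, max (max A K) 1, by positivity, ?_, ?_⟩
  · intro x hx
    exact b.zero_of_le_dist (by simpa using hx.le)
  · intro x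
    exact (hA x).trans ((le_max_left _ _).trans (le_max_left _ _))
  · intro x y
    refine (hK.norm_sub_le x y).trans ?_
    gcongr
    exact (le_max_right _ _).trans (le_max_left _ _)

lemma sum_ebasis (w : Ed d) : w = ∑ i, ⟪w, ebasis d i⟫ • ebasis d i := by
  have := (EuclideanSpace.basisFun (Fin d) ℝ).sum_repr w
  conv_lhs => rw [← this]
  simp [ebasis, EuclideanSpace.inner_single_right]

lemma div_ibp {φ : Ed d → ℝ} (hφ : ContDiff ℝ 1 φ) (hcs : HasCompactSupport φ)
    {W : Ed d → Ed d} (hW : ContDiff ℝ 1 W) :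
    Integrable (fun x => φ x * diverg W x) ∧ Integrable (fun x => fderiv ℝ φ x (W x)) ∧
    ∫ x, φ x * diverg W x = - ∫ x, fderiv ℝ φ x (W x) := by
  have hWi : ∀ i, ContDiff ℝ 1 (fun y => ⟪W y, ebasis d i⟫) := fun i => hW.inner ℝ contDiff_const
  have hd : ∀ x, diverg W x = ∑ i, fderiv ℝ (fun y => ⟪W y, ebasis d i⟫) x (ebasis d i) := by
    intro x
    unfold diverg
    refine Finset.sum_congr rfl fun i _ => ?_
    rw [fderiv_inner_apply ℝ (hW.differentiable (by norm_num) x) (differentiableAt_const _)]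
    simp
  have hf : ∀ x, fderiv ℝ φ x (W x) = ∑ i, fderiv ℝ φ x (ebasis d i) * ⟪W x, ebasis d i⟫ := by
    intro x
    conv_lhs => rw [sum_ebasis (W x)]
    simp [mul_comm]
  have hc1 : ∀ i, Continuous fun x => fderiv ℝ (fun y => ⟪W y, ebasis d i⟫) x (ebasis d i) := fun i =>
    ((hWi i).continuous_fderiv (by norm_num)).clm_apply continuous_const
  have hc2 : ∀ i, Continuous fun x => fderiv ℝ φ x (ebasis d i) := fun i =>
    (hφ.continuous_fderiv (by norm_num)).clm_apply continuous_const
  have k1 : ∀ i, Integrable fun x => φ x * fderiv ℝ (fun y => ⟪W y, ebasis d i⟫) x (ebasis d i) :=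
    fun i => (hφ.continuous.mul (hc1 i)).integrable_of_hasCompactSupport hcs.mul_right
  have k2 : ∀ i, Integrable fun x => fderiv ℝ φ x (ebasis d i) * ⟪W x, ebasis d i⟫ :=
    fun i => ((hc2 i).mul (hWi i).continuous).integrable_of_hasCompactSupport
      (HasCompactSupport.mul_right (hcs.fderiv_apply ℝ _))
  have k3 : ∀ i, Integrable fun x => φ x * ⟪W x, ebasis d i⟫ :=
    fun i => (hφ.continuous.mul (hWi i).continuous).integrable_of_hasCompactSupport hcs.mul_right
  simp_rw [hd, hf, Finset.mul_sum]
  refine ⟨integrable_finsetSum _ fun i _ => k1 i, integrable_finsetSum _ fun i _ => k2 i, ?_⟩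
  rw [integral_finsetSum _ fun i _ => k1 i, integral_finsetSum _ fun i _ => k2 i,
    ← Finset.sum_neg_distrib]
  refine Finset.sum_congr rfl fun i _ => ?_
  exact integral_mul_fderiv_eq_neg_fderiv_mul_of_integrable (k2 i) (k1 i) (k3 i)
    (fun x _ => hφ.differentiable (by norm_num) x) (fun x _ => (hWi i).differentiable (by norm_num) x)

lemma fixed_time (d : ℕ) : ∃ C1 : ℝ, 0 ≤ C1 ∧ ∀ (g g1 χ Ψ : Ed d → ℝ) (B Wb : Ed d → Ed d)
    (L M : ℝ), 0 ≤ L → (∀ x y, ‖B x - B y‖ ≤ L * ‖x - y‖) →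
    ZPeriodic g → ZPeriodic g1 → ZPeriodic χ → Measurable g → Measurable g1 → Measurable χ →
    (∀ x, |g x| ≤ M) → (∀ x, |g1 x| ≤ M) → (∀ x, |χ x| ≤ M) → (∀ x, ‖Wb x‖ ≤ M) →
    ContDiff ℝ 1 (fun x => g x • B x + Wb x) →
    (∀ x, diverg (fun x => g x • B x + Wb x) x = g1 x + Ψ x) → (∀ x, χ x ≤ Ψ x) →
    (∫ x in cube d, g1 x) + (∫ x in cube d, χ x) ≤ C1 * L * |∫ x in cube d, g x| := by
  obtain ⟨φ, hφ, hφ0, hφ1, hI, A, hA, hφA, hφL⟩ := exists_bump d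
  set I := ∫ x, φ x
  obtain ⟨K, hK0, hK⟩ := cube_bdd (d := d)
  set ω := volume.real (Metric.closedBall (0 : Ed d) 1) with hω
  have hω0 : 0 ≤ ω := measureReal_nonneg
  refine ⟨A * ω / I, by positivity, ?_⟩
  intro g g1 χ Ψ B Wb L M hL hB pg pg1 pχ mg mg1 mχ bg bg1 bχ bW hW hdiv hχ
  have hM : 0 ≤ M := (abs_nonneg _).trans (bg 0)
  have hBc : Continuous B := by
    have : LipschitzWith L.toNNReal B := LipschitzWith.of_dist_le_mul fun x y => by
      rw [dist_eq_norm, dist_eq_norm, Real.coe_toNNReal _ hL]; exact hB x y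
    exact this.continuous
  set gb := ∫ x in cube d, g x
  set a := (∫ x in cube d, g1 x) + (∫ x in cube d, χ x) with ha
  have hvol : ∀ R : ℝ, 0 ≤ R → volume.real (Metric.closedBall (0 : Ed d) R) = R ^ d * ω := by
    intro R hR
    rw [hω, measureReal_def, Measure.addHaar_closedBall _ _ hR, measureReal_def,
      Measure.addHaar_closedBall _ _ zero_le_one]
    simp [ENNReal.toReal_mul, hR]
  have hcubefin : IsFiniteMeasure (volume.restrict (cube d)) := ⟨by simp [cube_vol]⟩
  have hint : ∀ h : Ed d → ℝ, Measurable h → (∀ x, |h x| ≤ M) →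
      Integrable h (volume.restrict (cube d)) := fun h h1 h2 =>
    Integrable.of_bound h1.aestronglyMeasurable M (Filter.Eventually.of_forall h2)
  set C' := A * K * (2 * M) * ((1 + K) ^ d * ω) + 2 * L * A * K * M * ((1 + K) ^ d * ω) +
    A * (M * ‖B 0‖ + M) * ω with hC'
  have key : ∀ N : ℝ, 1 ≤ N → a * I ≤ L * A * ω * |gb| + C' / N := by
    intro N hN
    have hN0 : 0 < N := by linarith
    set φN : Ed d → ℝ := fun x => φ (N⁻¹ • x) with hφN
    have hφNc : ContDiff ℝ 2 φN := hφ.comp (contDiff_const_smul _)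
    have hfd : ∀ x, fderiv ℝ φN x = N⁻¹ • fderiv ℝ φ (N⁻¹ • x) := by
      intro x
      rw [hφN, fderiv_comp_smul]
    have hout : ∀ x : Ed d, N < ‖x‖ → 1 < ‖N⁻¹ • x‖ := by
      intro x hx
      rw [norm_smul, norm_inv, Real.norm_of_nonneg hN0.le, inv_mul_eq_div, lt_div_iff₀ hN0]
      linarith
    have hz : ∀ x, N < ‖x‖ → φN x = 0 := fun x hx => hφ1 _ (hout x hx)
    have hz' : ∀ x, N < ‖x‖ → fderiv ℝ φN x = 0 := by
      intro x hx
      have : φN =ᶠ[nhds x] fun _ => 0 := by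
        have ho : {y : Ed d | N < ‖y‖} ∈ nhds x :=
          (isOpen_lt continuous_const continuous_norm).mem_nhds hx
        filter_upwards [ho] with y hy using hz y hy
      rw [this.fderiv_eq]; simp
    have hb1 : ∀ x, ‖fderiv ℝ φN x‖ ≤ A / N := by
      intro x
      rw [hfd, norm_smul, norm_inv, Real.norm_of_nonneg hN0.le, inv_mul_eq_div]
      gcongr
      exact hφA _
    have hb2 : ∀ x y, ‖fderiv ℝ φN x - fderiv ℝ φN y‖ ≤ A / N ^ 2 * ‖x - y‖ := by
      intro x y
      rw [hfd, hfd, ← smul_sub, norm_smul, norm_inv, Real.norm_of_nonneg hN0.le]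
      have := hφL (N⁻¹ • x) (N⁻¹ • y)
      rw [← smul_sub, norm_smul, norm_inv, Real.norm_of_nonneg hN0.le] at this
      calc N⁻¹ * _ ≤ N⁻¹ * (A * (N⁻¹ * ‖x - y‖)) := by gcongr
        _ = _ := by field_simp
    have hcs : HasCompactSupport φN :=
      HasCompactSupport.intro (isCompact_closedBall (0 : Ed d) N) fun x hx => hz x (by simpa using hx)
    have hLipφ : ∀ x y, |φN x - φN y| ≤ A / N * ‖x - y‖ := by
      intro x y
      exact Convex.norm_image_sub_le_of_norm_fderiv_le (s := univ)
        (fun z _ => hφNc.differentiable (by norm_num) z) (fun z _ => hb1 z) convex_univ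
        (mem_univ y) (mem_univ x)
    set G2 : Ed d → ℝ := fun x => fderiv ℝ φN x (B x - B 0) with hG2
    have hG2c : Continuous G2 :=
      (hφNc.continuous_fderiv (by norm_num)).clm_apply (hBc.sub continuous_const)
    have hG2z : ∀ x, N < ‖x‖ → G2 x = 0 := fun x hx => by simp [hG2, hz' x hx]
    have hB0 : ∀ x, ‖B x - B 0‖ ≤ L * ‖x‖ := fun x => by simpa using hB x 0
    have hG2L0 : ∀ x y, ‖x‖ ≤ N → |G2 x - G2 y| ≤ 2 * L * A / N * ‖x - y‖ := by
      intro x y hx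
      have e : G2 x - G2 y = (fderiv ℝ φN x - fderiv ℝ φN y) (B x - B 0)
          + fderiv ℝ φN y (B x - B y) := by
        simp only [hG2, sub_apply, map_sub]; ring
      rw [e]
      have t1 : |(fderiv ℝ φN x - fderiv ℝ φN y) (B x - B 0)| ≤ A / N ^ 2 * ‖x - y‖ * (L * N) := by
        rw [← Real.norm_eq_abs]
        refine (ContinuousLinearMap.le_opNorm _ _).trans ?_
        refine mul_le_mul (hb2 x y) ((hB0 x).trans ?_) (norm_nonneg _) (by positivity)
        gcongr
      have t2 : |fderiv ℝ φN y (B x - B y)| ≤ A / N * (L * ‖x - y‖) := by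
        rw [← Real.norm_eq_abs]
        refine (ContinuousLinearMap.le_opNorm _ _).trans ?_
        exact mul_le_mul (hb1 y) (hB x y) (norm_nonneg _) (by positivity)
      refine (abs_add_le _ _).trans ((add_le_add t1 t2).trans (le_of_eq ?_))
      field_simp
      ring
    have hG2L : ∀ x y, |G2 x - G2 y| ≤ 2 * L * A / N * ‖x - y‖ := by
      intro x y
      by_cases hx : ‖x‖ ≤ N
      · exact hG2L0 x y hx
      by_cases hy : ‖y‖ ≤ N
      · rw [abs_sub_comm, norm_sub_rev]; exact hG2L0 y x hy
      · rw [hG2z x (by linarith), hG2z y (by linarith)]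
        simp only [sub_self, abs_zero]
        positivity
    -- integration by parts
    obtain ⟨ii1, ii2, ibp⟩ := div_ibp (hφNc.of_le (by norm_num)) hcs hW
    have hφi : Integrable φN := hφNc.continuous.integrable_of_hasCompactSupport hcs
    have hle : ∫ x, φN x * (g1 x + χ x) ≤ ∫ x, φN x * diverg (fun x => g x • B x + Wb x) x := by
      refine integral_mono ?_ ii1 ?_
      · exact hφi.mul_bdd (c := 2 * M) (mg1.add mχ).aestronglyMeasurable
          (Filter.Eventually.of_forall fun x => (abs_add_le _ _).trans (by linarith [bg1 x, bχ x]))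
      · intro x
        show φN x * (g1 x + χ x) ≤ φN x * diverg (fun x => g x • B x + Wb x) x
        rw [hdiv]
        have := hχ x
        have := hφ0 (N⁻¹ • x)
        exact mul_le_mul_of_nonneg_left (by linarith) this
    have hG2cs : HasCompactSupport G2 :=
      HasCompactSupport.intro (isCompact_closedBall (0 : Ed d) N) fun x hx => hG2z x (by simpa using hx)
    have hG2g : Integrable fun x => G2 x * g x :=
      (hG2c.integrable_of_hasCompactSupport hG2cs).mul_bdd (c := M) mg.aestronglyMeasurable
        (Filter.Eventually.of_forall bg)
    have hsplit : ∫ x, fderiv ℝ φN x (g x • B x + Wb x) = (∫ x, G2 x * g x) +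
        ∫ x, fderiv ℝ φN x (g x • B 0 + Wb x) := by
      have e : ∀ x, fderiv ℝ φN x (g x • B 0 + Wb x) =
          fderiv ℝ φN x (g x • B x + Wb x) - G2 x * g x := by
        intro x
        simp only [hG2, map_add, map_smul, map_sub, smul_eq_mul]; ring
      simp_rw [e]
      rw [integral_sub ii2 hG2g]; ring
    have hrest : |∫ x, fderiv ℝ φN x (g x • B 0 + Wb x)| ≤ A / N * (M * ‖B 0‖ + M) * (N ^ d * ω) := by
      rw [← setIntegral_eq_integral_of_forall_compl_eq_zero
        (s := Metric.closedBall (0 : Ed d) N) (fun x hx => by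
          rw [hz' x (by simpa using hx)]; simp), ← hvol N hN0.le]
      rw [← Real.norm_eq_abs]
      refine norm_setIntegral_le_of_norm_le_const (isCompact_closedBall (0 : Ed d) N).measure_lt_top ?_
      intro x _
      refine (ContinuousLinearMap.le_opNorm _ _).trans ?_
      refine mul_le_mul (hb1 x) ?_ (norm_nonneg _) (by positivity)
      refine (norm_add_le _ _).trans (add_le_add ?_ (bW x))
      rw [norm_smul]
      exact mul_le_mul_of_nonneg_right (bg x) (norm_nonneg _)
    have hintG2 : |∫ x, G2 x| ≤ L * A * (N ^ d * ω) := by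
      rw [← setIntegral_eq_integral_of_forall_compl_eq_zero
        (s := Metric.closedBall (0 : Ed d) N) (fun x hx => hG2z x (by simpa using hx)),
        ← hvol N hN0.le]
      rw [← Real.norm_eq_abs]
      refine norm_setIntegral_le_of_norm_le_const (isCompact_closedBall (0 : Ed d) N).measure_lt_top ?_
      intro x hx
      have hx' : ‖x‖ ≤ N := by simpa using hx
      refine (ContinuousLinearMap.le_opNorm _ _).trans ?_
      calc _ ≤ A / N * (L * N) := mul_le_mul (hb1 x) ((hB0 x).trans (by gcongr))
              (norm_nonneg _) (by positivity)
        _ = L * A := by field_simp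
    have hIN : ∫ x, φN x = N ^ d * I := by
      rw [hφN, Measure.integral_comp_inv_smul_of_nonneg _ _ hN0.le]
      simp [I]
    have hvb : volume.real (Metric.closedBall (0 : Ed d) (N + K)) ≤ (1 + K) ^ d * ω * N ^ d := by
      rw [hvol _ (by positivity)]
      have : (N + K) ^ d ≤ ((1 + K) * N) ^ d := by
        gcongr
        nlinarith
      rw [mul_pow] at this
      nlinarith
    have pgx : ZPeriodic fun x => g1 x + χ x := fun x i => by
      show g1 _ + χ _ = _
      rw [pg1, pχ]
    have av1 := averaging hφNc.continuous (Lp := A / N) (R := N) (M := 2 * M) (by positivity) hK hK0.le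
      hLipφ hz pgx (mg1.add mχ) (fun x => (abs_add_le _ _).trans (by linarith [bg1 x, bχ x]))
    have av2 := averaging hG2c (Lp := 2 * L * A / N) (R := N) (M := M) (by positivity) hK hK0.le
      hG2L hG2z pg mg bg
    rw [integral_add (hint _ mg1 bg1) (hint _ mχ bχ), hIN, ← ha] at av1
    have av1' : |(∫ x, φN x * (g1 x + χ x)) - N ^ d * I * a| ≤
        A / N * K * (2 * M) * ((1 + K) ^ d * ω * N ^ d) :=
      av1.trans (mul_le_mul_of_nonneg_left hvb (by positivity))
    have av2' : |(∫ x, G2 x * g x) - (∫ x, G2 x) * gb| ≤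
        2 * L * A / N * K * M * ((1 + K) ^ d * ω * N ^ d) :=
      av2.trans (mul_le_mul_of_nonneg_left hvb (by positivity))
    have hprod : |(∫ x, G2 x) * gb| ≤ L * A * (N ^ d * ω) * |gb| := by
      rw [abs_mul]; gcongr
    rw [ibp, hsplit] at hle
    have fin : N ^ d * (a * I) ≤ N ^ d * (L * A * ω * |gb| + C' / N) := by
      have e : N ^ d * (L * A * ω * |gb| + C' / N) = L * A * (N ^ d * ω) * |gb| +
        A / N * K * (2 * M) * ((1 + K) ^ d * ω * N ^ d) +
        2 * L * A / N * K * M * ((1 + K) ^ d * ω * N ^ d) + A / N * (M * ‖B 0‖ + M) * (N ^ d * ω) := by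
        rw [hC']; field_simp; ring
      rw [e]
      have h1 := (abs_le.1 av1').1
      have h2 := (abs_le.1 av2').1
      have h3 := (abs_le.1 hprod).1
      have h4 := (abs_le.1 hrest).1
      linarith
    exact le_of_mul_le_mul_left fin (by positivity)
  have hlim : a * I ≤ L * A * ω * |gb| := by
    have ht : Filter.Tendsto (fun N : ℝ => L * A * ω * |gb| + C' / N) Filter.atTop
        (nhds (L * A * ω * |gb| + 0)) :=
      tendsto_const_nhds.add (tendsto_const_nhds.div_atTop Filter.tendsto_id)
    rw [add_zero] at ht
    exact ge_of_tendsto ht (Filter.eventually_atTop.2 ⟨1, key⟩)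
  rw [show A * ω / I * L * |gb| = (L * A * ω * |gb|) / I by ring, le_div_iff₀ hI]
  exact hlim

lemma ode_half {T C : ℝ} {E E' : ℝ → ℝ} (hC : 0 ≤ C) (hE : ContinuousOn E (Icc 0 T))
    (hd : ∀ t ∈ Ioo 0 T, HasDerivAt E (E' t) t) (hle : ∀ t ∈ Ioo 0 T, E' t ≤ C * |E t|)
    (h0 : E 0 = 0) : ∀ t ∈ Ioo 0 T, E t ≤ 0 := by
  intro t ht
  have key : ∀ ε : ℝ, 0 < ε → E t ≤ ε * Real.exp ((C + 1) * t) := by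
    intro ε hε
    have hc0 : ContinuousWithinAt E (Icc 0 T) 0 := hE 0 ⟨le_rfl, (ht.1.trans ht.2).le⟩
    have hev : ∀ᶠ s in nhdsWithin 0 (Icc 0 T), E s < ε := by
      refine hc0.eventually_lt continuousWithinAt_const ?_
      rw [h0]; exact hε
    have hev2 : ∀ᶠ s in nhdsWithin (0:ℝ) (Ioo 0 t), E s < ε :=
      hev.filter_mono (nhdsWithin_mono _ (show Ioo 0 t ⊆ Icc 0 T from
        fun s hs => ⟨hs.1.le, (hs.2.trans ht.2).le⟩))
    have hne : (nhdsWithin (0:ℝ) (Ioo 0 t)).NeBot := by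
      rw [nhdsWithin_Ioo_eq_nhdsGT ht.1]; infer_instance
    obtain ⟨η, h1, h2⟩ := (hev2.and self_mem_nhdsWithin).exists
    have := image_le_of_deriv_right_lt_deriv_boundary' (f := E) (f' := E') (a := η) (b := t)
      (hE.mono fun s hs => ⟨h2.1.le.trans hs.1, hs.2.trans ht.2.le⟩)
      (fun s hs => (hd s ⟨h2.1.trans_le hs.1, hs.2.trans ht.2⟩).hasDerivWithinAt)
      (B := fun s => ε * Real.exp ((C + 1) * s))
      (B' := fun s => ε * (Real.exp ((C + 1) * s) * (C + 1))) ?_ (by fun_prop) ?_ ?_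
      (x := t) ⟨h2.2.le, le_rfl⟩
    · exact this
    · have : 1 ≤ Real.exp ((C + 1) * η) := Real.one_le_exp (by have := h2.1; positivity)
      nlinarith
    · intro s _
      have : HasDerivAt (fun s => (C + 1) * s) (C + 1) s := by
        simpa using (hasDerivAt_id s).const_mul (C + 1)
      exact (this.exp.const_mul ε).hasDerivWithinAt
    · intro s hs hEs
      have h3 := hle s ⟨h2.1.trans_le hs.1, hs.2.trans ht.2⟩
      have hp : 0 < ε * Real.exp ((C + 1) * s) := by positivity
      rw [hEs, abs_of_pos hp] at h3
      show _ < ε * (Real.exp ((C + 1) * s) * (C + 1))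
      nlinarith
  by_contra hcon
  push Not at hcon
  have h2 := key (E t / (2 * Real.exp ((C + 1) * t))) (by positivity)
  have : E t / (2 * Real.exp ((C + 1) * t)) * Real.exp ((C + 1) * t) = E t / 2 := by
    field_simp
  rw [this] at h2
  linarith

lemma ode_zero {T C : ℝ} {E E' : ℝ → ℝ} (hC : 0 ≤ C) (hE : ContinuousOn E (Icc 0 T))
    (hd : ∀ t ∈ Ioo 0 T, HasDerivAt E (E' t) t) (hle : ∀ t ∈ Ioo 0 T, E' t ≤ C * |E t|)
    (h0 : E 0 = 0) (hT : E T = 0) : ∀ t ∈ Ioo 0 T, E t = 0 := by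
  intro t ht
  refine le_antisymm (ode_half hC hE hd hle h0 t ht) ?_
  have := ode_half (T := T) (E := fun s => - E (T - s)) (E' := fun s => E' (T - s)) hC ?_ ?_ ?_ ?_
    (T - t) ⟨by linarith [ht.2], by linarith [ht.1]⟩
  · simp only [sub_sub_cancel] at this; linarith
  · refine (hE.comp (by fun_prop) ?_).neg
    intro s hs
    exact ⟨by linarith [hs.2], by linarith [hs.1]⟩
  · intro s hs
    have h1 := hd (T - s) ⟨by linarith [hs.2], by linarith [hs.1]⟩
    have h2 : HasDerivAt (fun s => T - s) (-1) s := by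
      simpa using (hasDerivAt_id s).const_sub T
    have := (h1.comp s h2).neg
    rw [mul_neg_one, neg_neg] at this
    exact this
  · intro s hs
    have := hle (T - s) ⟨by linarith [hs.2], by linarith [hs.1]⟩
    simpa using this
  · simp [hT]

lemma line_deriv (f : Ed d → ℝ) (hf : ContDiff ℝ 2 f) (x e : Ed d) (s : ℝ) :
    HasDerivAt (fun s : ℝ => f (x + s • e)) (fderiv ℝ f (x + s • e) e) s := by
  have h1 : HasDerivAt (fun s : ℝ => x + s • e) e s := by
    simpa using ((hasDerivAt_id s).smul_const e).const_add x
  exact ((hf.differentiable (by norm_num)) _).hasFDerivAt.comp_hasDerivAt s h1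

lemma partial2_nonpos {f : Ed d → ℝ} (hf : ContDiff ℝ 2 f) {x : Ed d} (hx : ∀ y, f y ≤ f x)
    (i : Fin d) : partial2 f i i x ≤ 0 := by
  set e := ebasis d i
  set h : ℝ → ℝ := fun s => f (x + s • e) with hh
  have hd1 : deriv h = fun s => fderiv ℝ f (x + s • e) e := by
    ext s; exact (line_deriv f hf x e s).deriv
  have hC1 : ContDiff ℝ 1 (fun y => fderiv ℝ f y e) :=
    (hf.fderiv_right (m := 1) (by norm_num)).clm_apply contDiff_const
  have hd2 : deriv (deriv h) 0 = partial2 f i i x := by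
    rw [hd1]
    have h1 : HasDerivAt (fun s : ℝ => x + s • e) e 0 := by
      simpa using ((hasDerivAt_id (0:ℝ)).smul_const e).const_add x
    have h2 : HasFDerivAt (fun y => fderiv ℝ f y e) (fderiv ℝ (fun y => fderiv ℝ f y e) x)
        (x + (0:ℝ) • e) := by
      simpa using (hC1.differentiable (by norm_num) x).hasFDerivAt
    exact (h2.comp_hasDerivAt (0:ℝ) h1).deriv
  have hmax : IsLocalMax h 0 := Filter.Eventually.of_forall fun s => by
    simpa [hh] using hx (x + s • e)
  by_contra hcon
  push Not at hcon
  rw [← hd2] at hcon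
  have hcont : ContinuousAt h 0 := (line_deriv f hf x e 0).continuousAt
  have hmin := isLocalMin_of_deriv_deriv_pos hcon hmax.deriv_eq_zero hcont
  have hconst : h =ᶠ[nhds 0] fun _ => h 0 := by
    filter_upwards [hmax, hmin] with s h1 h2 using le_antisymm h1 h2
  have h3 : deriv (deriv h) 0 = 0 := by
    rw [hconst.deriv.deriv_eq]
    simp
  linarith

lemma max_principle {T : ℝ} {w : ℝ → Ed d → ℝ}
    (hc : ContinuousOn (fun z : ℝ × Ed d => w z.1 z.2) (Icc 0 T ×ˢ univ))
    (hper : ∀ t ∈ Icc (0:ℝ) T, ZPeriodic (w t)) (hC2 : ∀ t ∈ Icc (0:ℝ) T, ContDiff ℝ 2 (w t))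
    (htd : ∀ x : Ed d, DifferentiableOn ℝ (fun s => w s x) (Icc 0 T))
    (hterm : ∀ x, w T x = 0)
    (hcrit : ∀ t ∈ Ico (0:ℝ) T, ∀ x, sgrad (w t) x = 0 → tderiv T w t x = - lap (w t) x) :
    ∀ t ∈ Icc (0:ℝ) T, ∀ x : Ed d, w t x ≤ 0 := by
  intro t0 ht0 x0
  by_contra hcon
  push Not at hcon
  have hT0 : 0 ≤ T := ht0.1.trans ht0.2
  set ε := w t0 x0 / (2 * (T + 1)) with hε
  have hε0 : 0 < ε := by positivity
  have hεT : ε * T < w t0 x0 := by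
    rw [hε, div_mul_eq_mul_div, div_lt_iff₀ (by positivity)]; nlinarith
  obtain ⟨K, hK0, hK⟩ := cube_bdd (d := d)
  set S : Set (ℝ × Ed d) := Icc 0 T ×ˢ Metric.closedBall 0 K
  have hS : IsCompact S := isCompact_Icc.prod (isCompact_closedBall _ _)
  have hcont : ContinuousOn (fun z : ℝ × Ed d => w z.1 z.2 + ε * z.1) S :=
    (hc.mono (prod_mono le_rfl (subset_univ _))).add (by fun_prop)
  obtain ⟨⟨t1, x1⟩, hz, hmax⟩ := hS.exists_isMaxOn
    ⟨(0, 0), ⟨⟨le_rfl, hT0⟩, by simp [hK0.le]⟩⟩ hcont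
  have hm : ∀ t ∈ Icc 0 T, ∀ x, w t x + ε * t ≤ w t1 x1 + ε * t1 := by
    intro t ht x
    obtain ⟨k, hk, hxk⟩ := exists_cube x
    have := hmax (show (t, x - k) ∈ S from ⟨ht, by simpa using hK _ hxk⟩)
    have h2 := per_lat (hper t ht) hk (x - k)
    rw [sub_add_cancel] at h2
    rw [h2]
    exact this
  have ht1 : t1 ∈ Icc 0 T := hz.1
  have ht1T : t1 < T := by
    refine lt_of_le_of_ne ht1.2 fun h => ?_
    have := hm t0 ht0 x0
    rw [h, hterm] at this
    nlinarith [mul_nonneg hε0.le ht0.1]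
  have hxmax : ∀ y, w t1 y ≤ w t1 x1 := fun y => by
    have := hm t1 ht1 y; linarith
  have hgrad : sgrad (w t1) x1 = 0 := by
    have : IsLocalMax (w t1) x1 := Filter.Eventually.of_forall hxmax
    simp [sgrad, gradient, this.fderiv_eq_zero]
  have hlap : lap (w t1) x1 ≤ 0 :=
    Finset.sum_nonpos fun i _ => partial2_nonpos (hC2 t1 ht1) hxmax i
  have hde : tderiv T w t1 x1 ≤ -ε := by
    have hd : HasDerivWithinAt (fun s => w s x1) (tderiv T w t1 x1) (Icc 0 T) t1 :=
      (htd x1 t1 ht1).hasDerivWithinAt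
    have hd2 : HasDerivWithinAt (fun s => w s x1) (tderiv T w t1 x1) (Ioo t1 T) t1 :=
      hd.mono fun s hs => ⟨ht1.1.trans hs.1.le, hs.2.le⟩
    rw [hasDerivWithinAt_iff_tendsto_slope' (by simp)] at hd2
    have hne : (nhdsWithin t1 (Ioo t1 T)).NeBot := by
      rw [nhdsWithin_Ioo_eq_nhdsGT ht1T]; infer_instance
    refine le_of_tendsto hd2 ?_
    filter_upwards [self_mem_nhdsWithin] with s hs
    have := hm s ⟨ht1.1.trans hs.1.le, hs.2.le⟩ x1
    rw [slope_def_field, div_le_iff₀ (by linarith [hs.1])]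
    linarith
  have := hcrit t1 ⟨ht1.1, ht1T⟩ x1 hgrad
  linarith

/-- the domain of the Hamiltonian -/
def Odom (d : ℕ) : Set (Ed d × ℝ × Ed d) := {q | 0 < q.2.1}

lemma Odom_open : IsOpen (Odom d) :=
  isOpen_lt continuous_const (continuous_fst.comp continuous_snd)

lemma grad_eq {F : Type*} [NormedAddCommGroup F] [InnerProductSpace ℝ F] [CompleteSpace F]
    (f : F → ℝ) (x : F) : gradient f x = (InnerProductSpace.toDual ℝ F).symm (fderiv ℝ f x) := rfl

lemma inner_grad (f : Ed d → ℝ) (x v : Ed d) : ⟪gradient f x, v⟫ = fderiv ℝ f x v := by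
  rw [grad_eq, InnerProductSpace.toDual_symm_apply]

section partials
variable {F : Type*} [NormedAddCommGroup F] [NormedSpace ℝ F]

/-- inclusion of the x-, m- and p-directions -/
def inX (d : ℕ) : Ed d →L[ℝ] Ed d × ℝ × Ed d := ContinuousLinearMap.inl ℝ _ _
def inM (d : ℕ) : ℝ →L[ℝ] Ed d × ℝ × Ed d :=
  (ContinuousLinearMap.inr ℝ (Ed d) (ℝ × Ed d)).comp (ContinuousLinearMap.inl ℝ ℝ (Ed d))
def inP (d : ℕ) : Ed d →L[ℝ] Ed d × ℝ × Ed d :=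
  (ContinuousLinearMap.inr ℝ (Ed d) (ℝ × Ed d)).comp (ContinuousLinearMap.inr ℝ ℝ (Ed d))

lemma partX {Φ : Ed d × ℝ × Ed d → F} {x : Ed d} {m : ℝ} {p : Ed d}
    (h : DifferentiableAt ℝ Φ (x, m, p)) :
    HasFDerivAt (fun y => Φ (y, m, p)) ((fderiv ℝ Φ (x, m, p)).comp (inX d)) x :=
  h.hasFDerivAt.comp x ((hasFDerivAt_id x).prodMk (hasFDerivAt_const (m, p) x))

lemma partM {Φ : Ed d × ℝ × Ed d → F} {x : Ed d} {m : ℝ} {p : Ed d}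
    (h : DifferentiableAt ℝ Φ (x, m, p)) :
    HasFDerivAt (fun s => Φ (x, s, p)) ((fderiv ℝ Φ (x, m, p)).comp (inM d)) m := by
  have := ((hasFDerivAt_const x m).prodMk ((hasFDerivAt_id (𝕜 := ℝ) m).prodMk (hasFDerivAt_const p m)))
  exact h.hasFDerivAt.comp m this

lemma partP {Φ : Ed d × ℝ × Ed d → F} {x : Ed d} {m : ℝ} {p : Ed d}
    (h : DifferentiableAt ℝ Φ (x, m, p)) :
    HasFDerivAt (fun q => Φ (x, m, q)) ((fderiv ℝ Φ (x, m, p)).comp (inP d)) p := by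
  have := ((hasFDerivAt_const x p).prodMk ((hasFDerivAt_const m p).prodMk (hasFDerivAt_id (𝕜 := ℝ) p)))
  exact h.hasFDerivAt.comp p this

lemma diffAt_of {n : WithTop ℕ∞} {Φ : Ed d × ℝ × Ed d → F} (hn : n ≠ 0)
    (h : ContDiffOn ℝ n Φ (Odom d)) {x : Ed d} {m : ℝ} {p : Ed d} (hm : 0 < m) :
    DifferentiableAt ℝ Φ (x, m, p) :=
  (h.contDiffAt (Odom_open.mem_nhds hm)).differentiableAt hn

lemma smooth_partP {n k : WithTop ℕ∞} (hk : k + 1 ≤ n) {Φ : Ed d × ℝ × Ed d → F}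
    (h : ContDiffOn ℝ n Φ (Odom d)) :
    ContDiffOn ℝ k (fun q => fderiv ℝ (fun p => Φ (q.1, q.2.1, p)) q.2.2) (Odom d) := by
  have h1 : ContDiffOn ℝ k (fun q => (fderiv ℝ Φ q).comp (inP d)) (Odom d) :=
    (h.fderiv_of_isOpen Odom_open hk).clm_comp contDiffOn_const
  refine h1.congr ?_
  rintro ⟨x, m, p⟩ hq
  refine (partP (diffAt_of (n := n) ?_ h hq)).fderiv
  rintro rfl
  simp at hk

lemma smooth_partM {n k : WithTop ℕ∞} (hk : k + 1 ≤ n) {Φ : Ed d × ℝ × Ed d → F}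
    (h : ContDiffOn ℝ n Φ (Odom d)) :
    ContDiffOn ℝ k (fun q => deriv (fun s => Φ (q.1, s, q.2.2)) q.2.1) (Odom d) := by
  have h1 : ContDiffOn ℝ k (fun q => (fderiv ℝ Φ q) (inM d 1)) (Odom d) :=
    (h.fderiv_of_isOpen Odom_open hk).clm_apply contDiffOn_const
  refine h1.congr ?_
  rintro ⟨x, m, p⟩ hq
  refine (partM (diffAt_of (n := n) ?_ h hq)).hasDerivAt.deriv
  rintro rfl
  simp at hk

end partials

section hamiltonian
variable {H : Ed d → ℝ → Ed d → ℝ}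

lemma HamP_smooth
    (hH : ContDiffOn ℝ 4 (fun q : Ed d × ℝ × Ed d => H q.1 q.2.1 q.2.2) (Odom d)) :
    ContDiffOn ℝ 3 (fun q : Ed d × ℝ × Ed d => HamP H q.1 q.2.1 q.2.2) (Odom d) := by
  have := smooth_partP (k := 3) (by norm_num) hH
  exact (InnerProductSpace.toDual ℝ (Ed d)).symm.toContinuousLinearEquiv.contDiff.comp_contDiffOn this

lemma HamM_smooth
    (hH : ContDiffOn ℝ 4 (fun q : Ed d × ℝ × Ed d => H q.1 q.2.1 q.2.2) (Odom d)) :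
    ContDiffOn ℝ 3 (fun q : Ed d × ℝ × Ed d => HamM H q.1 q.2.1 q.2.2) (Odom d) :=
  smooth_partM (k := 3) (by norm_num) hH

lemma HamPM_smooth
    (hH : ContDiffOn ℝ 4 (fun q : Ed d × ℝ × Ed d => H q.1 q.2.1 q.2.2) (Odom d)) :
    ContDiffOn ℝ 2 (fun q : Ed d × ℝ × Ed d => HamPM H q.1 q.2.1 q.2.2) (Odom d) := by
  have := smooth_partP (k := 2) (by norm_num) (HamM_smooth hH)
  exact (InnerProductSpace.toDual ℝ (Ed d)).symm.toContinuousLinearEquiv.contDiff.comp_contDiffOn this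

lemma HamPP_smooth
    (hH : ContDiffOn ℝ 4 (fun q : Ed d × ℝ × Ed d => H q.1 q.2.1 q.2.2) (Odom d)) :
    ContDiffOn ℝ 2 (fun q : Ed d × ℝ × Ed d => HamPP H q.1 q.2.1 q.2.2) (Odom d) :=
  smooth_partP (k := 2) (by norm_num) (HamP_smooth hH)

/-- Schwarz: `∂_m H_p = H_pm`. -/
lemma HamP_deriv_m
    (hH : ContDiffOn ℝ 4 (fun q : Ed d × ℝ × Ed d => H q.1 q.2.1 q.2.2) (Odom d))
    {x : Ed d} {m : ℝ} {p : Ed d} (hm : 0 < m) :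
    fderiv ℝ (fun q : Ed d × ℝ × Ed d => HamP H q.1 q.2.1 q.2.2) (x, m, p) (inM d 1) =
      HamPM H x m p := by
  set J := fun q : Ed d × ℝ × Ed d => H q.1 q.2.1 q.2.2 with hJ
  have hO : Odom d ∈ nhds (x, m, p) := Odom_open.mem_nhds hm
  have hJ1 : ContDiffOn ℝ 3 (fderiv ℝ J) (Odom d) := hH.fderiv_of_isOpen Odom_open (by norm_num)
  have hJd : DifferentiableAt ℝ (fderiv ℝ J) (x, m, p) := diffAt_of (by norm_num) hJ1 hm
  have hsym : IsSymmSndFDerivAt ℝ J (x, m, p) :=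
    (hH.contDiffAt hO).isSymmSndFDerivAt (by simp; norm_num)
  refine ext_inner_right ℝ fun c => ?_
  have hPd : DifferentiableAt ℝ (fun q : Ed d × ℝ × Ed d => HamP H q.1 q.2.1 q.2.2) (x, m, p) :=
    diffAt_of (by norm_num) (HamP_smooth hH) hm
  have e1 : ⟪fderiv ℝ (fun q : Ed d × ℝ × Ed d => HamP H q.1 q.2.1 q.2.2) (x, m, p) (inM d 1), c⟫
      = fderiv ℝ (fderiv ℝ J) (x, m, p) (inM d 1) (inP d c) := by
    have a1 : fderiv ℝ (fun q : Ed d × ℝ × Ed d => ⟪HamP H q.1 q.2.1 q.2.2, c⟫) (x, m, p) (inM d 1)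
        = ⟪fderiv ℝ (fun q : Ed d × ℝ × Ed d => HamP H q.1 q.2.1 q.2.2) (x, m, p) (inM d 1), c⟫ := by
      rw [fderiv_inner_apply ℝ hPd (differentiableAt_const _)]
      simp
    rw [← a1]
    have a2 : (fun q : Ed d × ℝ × Ed d => ⟪HamP H q.1 q.2.1 q.2.2, c⟫) =ᶠ[nhds (x, m, p)]
        fun q => fderiv ℝ J q (inP d c) := by
      filter_upwards [hO] with q hq
      obtain ⟨y, s, r⟩ := q
      show ⟪gradient (H y s) r, c⟫ = _
      rw [inner_grad]
      have := (partP (Φ := J) (diffAt_of (by norm_num) hH (x := y) (p := r) hq)).fderiv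
      exact congrArg (fun A => A c) this
    rw [a2.fderiv_eq, fderiv_clm_apply hJd (differentiableAt_const _)]
    simp
  have e2 : ⟪HamPM H x m p, c⟫ = fderiv ℝ (fderiv ℝ J) (x, m, p) (inP d c) (inM d 1) := by
    unfold HamPM
    rw [inner_grad]
    have hMd : DifferentiableAt ℝ (fun q : Ed d × ℝ × Ed d => HamM H q.1 q.2.1 q.2.2) (x, m, p) :=
      diffAt_of (by norm_num) (HamM_smooth hH) hm
    have a0 := (partP (Φ := fun q : Ed d × ℝ × Ed d => HamM H q.1 q.2.1 q.2.2) hMd).fderiv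
    have a1 : fderiv ℝ (fun q => HamM H x m q) p c = fderiv ℝ
      (fun q : Ed d × ℝ × Ed d => HamM H q.1 q.2.1 q.2.2) (x, m, p) (inP d c) :=
      congrArg (fun A => A c) a0
    rw [a1]
    have a2 : (fun q : Ed d × ℝ × Ed d => HamM H q.1 q.2.1 q.2.2) =ᶠ[nhds (x, m, p)]
        fun q => fderiv ℝ J q (inM d 1) := by
      filter_upwards [hO] with q hq
      obtain ⟨y, s, r⟩ := q
      exact (partM (Φ := J) (diffAt_of (by norm_num) hH (x := y) (p := r) hq)).hasDerivAt.deriv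
    rw [a2.fderiv_eq, fderiv_clm_apply hJd (differentiableAt_const _)]
    simp
  rw [e1, e2]
  exact hsym _ _

/-- Full derivative bound of `H_p`. -/
lemma HamP_fderiv_bound
    (hH : ContDiffOn ℝ 4 (fun q : Ed d × ℝ × Ed d => H q.1 q.2.1 q.2.2) (Odom d))
    {x : Ed d} {m : ℝ} {p : Ed d} (hm : 0 < m) (a c : Ed d) (b : ℝ) :
    ‖fderiv ℝ (fun q : Ed d × ℝ × Ed d => HamP H q.1 q.2.1 q.2.2) (x, m, p) (a, b, c)‖ ≤
      ‖fderiv ℝ (fun y => HamP H y m p) x‖ * ‖a‖ + ‖HamPM H x m p‖ * |b| +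
        ‖HamPP H x m p‖ * ‖c‖ := by
  set P := fun q : Ed d × ℝ × Ed d => HamP H q.1 q.2.1 q.2.2
  have hPd : DifferentiableAt ℝ P (x, m, p) := diffAt_of (by norm_num) (HamP_smooth hH) hm
  have e : ((a, b, c) : Ed d × ℝ × Ed d) = inX d a + b • inM d 1 + inP d c := by
    simp [inX, inM, inP]
  rw [e, map_add, map_add, map_smul, HamP_deriv_m hH hm]
  have h1 : fderiv ℝ P (x, m, p) (inX d a) = fderiv ℝ (fun y => HamP H y m p) x a :=
    (congrArg (fun A => A a) (partX hPd).fderiv).symm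
  have h2 : fderiv ℝ P (x, m, p) (inP d c) = HamPP H x m p c :=
    (congrArg (fun A => A c) (partP hPd).fderiv).symm
  rw [h1, h2]
  refine (norm_add_le _ _).trans (add_le_add ((norm_add_le _ _).trans (add_le_add ?_ ?_)) ?_)
  · exact ContinuousLinearMap.le_opNorm _ _
  · rw [norm_smul, mul_comm]; rfl
  · exact ContinuousLinearMap.le_opNorm _ _

lemma clm_bound {A : Ed d →L[ℝ] Ed d} {K : ℝ} (hK : 0 ≤ K)
    (h : ∀ i j, |⟪A (ebasis d j), ebasis d i⟫| ≤ K) : ‖A‖ ≤ d * (d * K) := by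
  have hv : ∀ w : Ed d, (∀ i, |⟪w, ebasis d i⟫| ≤ K) → ‖w‖ ≤ d * K := by
    intro w hw
    rw [sum_ebasis w]
    refine (norm_sum_le _ _).trans ?_
    refine (Finset.sum_le_card_nsmul _ _ K fun i _ => ?_).trans (by simp)
    rw [norm_smul]
    simpa [ebasis] using hw i
  refine ContinuousLinearMap.opNorm_le_bound _ (by positivity) fun a => ?_
  conv_lhs => rw [sum_ebasis a]
  rw [map_sum]
  refine (norm_sum_le _ _).trans ?_
  refine (Finset.sum_le_card_nsmul _ _ (d * K * ‖a‖) fun i _ => ?_).trans (by simp; ring_nf; rfl)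
  rw [map_smul, norm_smul, mul_comm]
  refine mul_le_mul (hv _ fun j => h j i) ?_ (norm_nonneg _) (by positivity)
  refine (norm_inner_le_norm _ _).trans ?_
  simp [ebasis]

lemma vec_bound {w : Ed d} {K : ℝ} (hw : ∀ i, |⟪w, ebasis d i⟫| ≤ K) : ‖w‖ ≤ d * K := by
  rw [sum_ebasis w]
  refine (norm_sum_le _ _).trans ?_
  refine (Finset.sum_le_card_nsmul _ _ K fun i _ => ?_).trans (by simp)
  rw [norm_smul]
  simpa [ebasis] using hw i

lemma sgrad_contDiff {f : Ed d → ℝ} (hf : ContDiff ℝ 2 f) : ContDiff ℝ 1 (sgrad f) :=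
  (InnerProductSpace.toDual ℝ (Ed d)).symm.toContinuousLinearEquiv.contDiff.comp
    (hf.fderiv_right (m := 1) (by norm_num))

lemma sgrad_fderiv {f : Ed d → ℝ} (hf : ContDiff ℝ 2 f) (x : Ed d) (i j : Fin d) :
    ⟪fderiv ℝ (sgrad f) x (ebasis d j), ebasis d i⟫ = partial2 f j i x := by
  have h1 : fderiv ℝ (fun y => ⟪sgrad f y, ebasis d i⟫) x (ebasis d j) =
      ⟪fderiv ℝ (sgrad f) x (ebasis d j), ebasis d i⟫ := by
    rw [fderiv_inner_apply ℝ ((sgrad_contDiff hf).differentiable (by norm_num) x)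
      (differentiableAt_const _)]
    simp
  rw [← h1]
  simp only [sgrad, inner_grad]
  rfl

lemma sgrad_per {f : Ed d → ℝ} (hf : ZPeriodic f) (x : Ed d) (i : Fin d) :
    sgrad f (x + ebasis d i) = sgrad f x := by
  have : f = fun y => f (y + ebasis d i) := by ext y; exact (hf y i).symm
  unfold sgrad
  rw [grad_eq, grad_eq]
  conv_rhs => rw [this, fderiv_comp_add_right]

/-- Uniform bounds extracted from the Hölder space. -/
lemma reg_bounds {T a : ℝ} {w : ℝ → Ed d → ℝ} (h : InC2alpha T a w) :
    ∃ K : ℝ, 0 ≤ K ∧ ∀ t ∈ Icc (0:ℝ) T, ∀ x, |w t x| ≤ K ∧ ‖sgrad (w t) x‖ ≤ K ∧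
      ‖fderiv ℝ (sgrad (w t)) x‖ ≤ K ∧ |tderiv T w t x| ≤ K := by
  obtain ⟨_, hC2, _, ⟨K1, hK1, _⟩, h2, h3, ⟨K4, hK4, _⟩⟩ := h
  choose K2 hK2 _ using h2
  choose K3 hK3 _ using h3
  set S2 := ∑ i, |K2 i|
  set S3 := ∑ i, ∑ j, |K3 i j|
  have hS2 : 0 ≤ S2 := Finset.sum_nonneg fun _ _ => abs_nonneg _
  have hS3 : 0 ≤ S3 := Finset.sum_nonneg fun _ _ => Finset.sum_nonneg fun _ _ => abs_nonneg _
  have b2 : ∀ i, K2 i ≤ S2 := fun i => (le_abs_self _).trans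
    (Finset.single_le_sum (f := fun i => |K2 i|) (fun _ _ => abs_nonneg _) (Finset.mem_univ i))
  have b3 : ∀ i j, K3 i j ≤ S3 := fun i j => (le_abs_self _).trans
    ((Finset.single_le_sum (f := fun j => |K3 i j|) (fun _ _ => abs_nonneg _) (Finset.mem_univ j)).trans
    (Finset.single_le_sum (f := fun i => ∑ j, |K3 i j|)
      (fun _ _ => Finset.sum_nonneg fun _ _ => abs_nonneg _) (Finset.mem_univ i)))
  have p2 : 0 ≤ d * S2 := by positivity
  have p3 : 0 ≤ d * (d * S3) := by positivity
  refine ⟨|K1| + d * S2 + d * (d * S3) + |K4|, by positivity, fun t ht x => ⟨?_, ?_, ?_, ?_⟩⟩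
  · have := hK1 t ht x
    have := le_abs_self K1
    have := abs_nonneg K4
    linarith
  · have := vec_bound (w := sgrad (w t) x) (K := S2) fun i => (hK2 i t ht x).trans (b2 i)
    have := abs_nonneg K1
    have := abs_nonneg K4
    linarith
  · have := clm_bound (A := fderiv ℝ (sgrad (w t)) x) hS3 fun i j => by
      rw [sgrad_fderiv (hC2 t ht)]
      exact (hK3 j i t ht x).trans (b3 j i)
    have := abs_nonneg K1
    have := abs_nonneg K4
    linarith
  · have := hK4 t ht x
    have := le_abs_self K4
    have := abs_nonneg K1
    linarith

/-- Joint continuity on `[0,T] × ℝ^d`. -/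
lemma holder_cont {T a : ℝ} (ha : 0 < a) {w : ℝ → Ed d → ℝ} (h : HolderBddQ T a w) :
    ContinuousOn (fun z : ℝ × Ed d => w z.1 z.2) (Icc 0 T ×ˢ univ) := by
  obtain ⟨C, _, hC⟩ := h
  intro z hz
  have hlim : Filter.Tendsto (fun y : ℝ × Ed d => C * (‖y.2 - z.2‖ ^ 2 + |y.1 - z.1|) ^ (a / 2))
      (nhdsWithin z (Icc 0 T ×ˢ univ)) (nhds 0) := by
    have hc : Continuous fun y : ℝ × Ed d => C * (‖y.2 - z.2‖ ^ 2 + |y.1 - z.1|) ^ (a / 2) := by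
      refine continuous_const.mul (Continuous.rpow_const (by fun_prop) fun x => Or.inr (by positivity))
    have := (hc.tendsto z).mono_left (nhdsWithin_le_nhds (s := Icc 0 T ×ˢ univ))
    simpa [Real.zero_rpow (show a / 2 ≠ 0 by positivity)] using this
  rw [ContinuousWithinAt, tendsto_iff_dist_tendsto_zero]
  refine squeeze_zero' (Filter.Eventually.of_forall fun _ => dist_nonneg) ?_ hlim
  filter_upwards [self_mem_nhdsWithin] with y hy
  exact hC y.1 hy.1 z.1 hz.1 y.2 z.2

end hamiltonian

lemma diverg_add {F G : Ed d → Ed d} {x : Ed d} (hF : DifferentiableAt ℝ F x)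
    (hG : DifferentiableAt ℝ G x) :
    diverg (fun y => F y + G y) x = diverg F x + diverg G x := by
  unfold diverg
  rw [fderiv_fun_add hF hG, ← Finset.sum_add_distrib]
  exact Finset.sum_congr rfl fun i _ => by simp [inner_add_left]

lemma diverg_sub {F G : Ed d → Ed d} {x : Ed d} (hF : DifferentiableAt ℝ F x)
    (hG : DifferentiableAt ℝ G x) :
    diverg (fun y => F y - G y) x = diverg F x - diverg G x := by
  unfold diverg
  rw [fderiv_fun_sub hF hG, ← Finset.sum_sub_distrib]
  exact Finset.sum_congr rfl fun i _ => by simp [inner_sub_left]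

lemma diverg_smul {f : Ed d → ℝ} {F : Ed d → Ed d} {x : Ed d} (hf : DifferentiableAt ℝ f x)
    (hF : DifferentiableAt ℝ F x) :
    diverg (fun y => f y • F y) x = f x * diverg F x + ⟪sgrad f x, F x⟫ := by
  unfold diverg
  have h1 : ⟪sgrad f x, F x⟫ = ∑ i, ⟪F x, ebasis d i⟫ * fderiv ℝ f x (ebasis d i) := by
    unfold sgrad
    rw [inner_grad]
    conv_lhs => rw [sum_ebasis (F x)]
    simp
  rw [fderiv_fun_smul hf hF, h1, Finset.mul_sum, ← Finset.sum_add_distrib]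
  refine Finset.sum_congr rfl fun i _ => ?_
  simp [inner_add_left, real_inner_smul_left]
  ring

lemma diverg_sgrad {f : Ed d → ℝ} (hf : ContDiff ℝ 2 f) (x : Ed d) :
    diverg (sgrad f) x = lap f x := by
  unfold diverg lap
  exact Finset.sum_congr rfl fun i _ => sgrad_fderiv hf x i i

/-- quantitative Harnack-type bound for nonnegative functions with bounded Hessian -/
lemma semi_bound {ψ : Ed d → ℝ} (h2 : ContDiff ℝ 2 ψ) (h0 : ∀ x, 0 ≤ ψ x) {C : ℝ}
    (hC : ∀ x, ‖iteratedFDeriv ℝ 2 ψ x‖ ≤ C) (z y : Ed d) (hy : ‖y‖ ≤ 1) :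
    (1 - ‖y‖) * ψ z - ‖y‖ * (C / 2) ≤ ψ (z + y) := by
  rcases eq_or_ne y 0 with rfl | hne
  · simp
  have hyp : 0 < ‖y‖ := norm_pos_iff.mpr hne
  set e : Ed d := ‖y‖⁻¹ • y with he
  have hen : ‖e‖ = 1 := by rw [he, norm_smul, norm_inv, norm_norm]; field_simp
  have hye : ‖y‖ • e = y := by rw [he, smul_smul, mul_inv_cancel₀ hyp.ne', one_smul]
  have hC0 : 0 ≤ C := (norm_nonneg _).trans (hC 0)
  have hd1 : ∀ s : ℝ, HasDerivAt (fun s : ℝ => ψ (z + s • e) - C / 2 * s ^ 2)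
      (fderiv ℝ ψ (z + s • e) e - C * s) s := by
    intro s
    have h := (line_deriv ψ h2 z e s).sub ((hasDerivAt_pow 2 s).const_mul (C / 2))
    refine h.congr_deriv ?_
    simp; ring
  have hd2 : ∀ s : ℝ, HasDerivAt (fun s : ℝ => fderiv ℝ ψ (z + s • e) e - C * s)
      (fderiv ℝ (fderiv ℝ ψ) (z + s • e) e e - C) s := by
    intro s
    have hl : HasDerivAt (fun s : ℝ => z + s • e) e s := by
      simpa using ((hasDerivAt_id s).smul_const e).const_add z
    have hF : HasFDerivAt (fderiv ℝ ψ) (fderiv ℝ (fderiv ℝ ψ) (z + s • e)) (z + s • e) :=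
      ((h2.fderiv_right (m := 1) (by norm_num)).differentiable (by norm_num) _).hasFDerivAt
    have h3 := hF.comp_hasDerivAt s hl
    have h4 := h3.clm_apply (hasDerivAt_const s e)
    have h5 := h4.sub ((hasDerivAt_id s).const_mul C)
    refine h5.congr_deriv ?_
    simp
  have hconc : ConcaveOn ℝ (Icc (0:ℝ) 1) (fun s : ℝ => ψ (z + s • e) - C / 2 * s ^ 2) := by
    have hde : deriv (fun s : ℝ => ψ (z + s • e) - C / 2 * s ^ 2) =
      (fun s : ℝ => fderiv ℝ ψ (z + s • e) e - C * s) := funext fun s => (hd1 s).deriv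
    refine concaveOn_of_deriv2_nonpos' (convex_Icc 0 1)
      (fun s _ => (hd1 s).differentiableAt.differentiableWithinAt) ?_ ?_
    · rw [hde]
      exact fun s _ => (hd2 s).differentiableAt.differentiableWithinAt
    · intro s _
      show deriv (deriv (fun s : ℝ => ψ (z + s • e) - C / 2 * s ^ 2)) s ≤ 0
      rw [hde, (hd2 s).deriv]
      have h6 := (iteratedFDeriv ℝ 2 ψ (z + s • e)).le_opNorm ![e, e]
      rw [iteratedFDeriv_two_apply] at h6
      simp [Fin.prod_univ_two, hen] at h6
      have := hC (z + s • e)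
      have := le_abs_self (fderiv ℝ (fderiv ℝ ψ) (z + s • e) e e)
      linarith
  have hh := hconc.2 (left_mem_Icc.mpr zero_le_one) (right_mem_Icc.mpr zero_le_one)
    (show 0 ≤ 1 - ‖y‖ by linarith) hyp.le (by ring)
  simp only [smul_eq_mul, mul_zero, mul_one, zero_add, zero_smul, add_zero, one_smul, hye] at hh
  have := h0 (z + e)
  nlinarith [mul_nonneg hyp.le this, mul_nonneg hC0 (sq_nonneg ‖y‖)]

lemma HamM_var {H : Ed d → ℝ → Ed d → ℝ}
    (hH : ContDiffOn ℝ 4 (fun q : Ed d × ℝ × Ed d => H q.1 q.2.1 q.2.2) (Odom d))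
    {Cb K : ℝ} (hCb : 0 ≤ Cb) 
    (hPM : ∀ x m, 0 < m → ∀ p, ‖HamPM H x m p‖ ≤ Cb * ‖p‖)
    (hMM : ∀ x m, 0 < m → ∀ p, |HamMM H x m p| ≤ Cb * ‖p‖ ^ 2)
    (x : Ed d) {m m' : ℝ} (hm : 0 < m) (hm' : 0 < m') {p p' : Ed d} (hp : ‖p‖ ≤ K)
    (hp' : ‖p'‖ ≤ K) :
    |HamM H x m' p' - HamM H x m p| ≤ Cb * K ^ 2 * |m' - m| + Cb * K * ‖p' - p‖ := by
  have hK : 0 ≤ K := (norm_nonneg _).trans hp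
  have hS := HamM_smooth hH
  have h1 : ‖HamM H x m' p - HamM H x m p‖ ≤ Cb * K ^ 2 * ‖m' - m‖ := by
    refine (convex_Ioi (0:ℝ)).norm_image_sub_le_of_norm_deriv_le (f := fun s => HamM H x s p)
      (fun s hs => ?_) (fun s hs => ?_) hm hm'
    · exact (partM (Φ := fun q : Ed d × ℝ × Ed d => HamM H q.1 q.2.1 q.2.2)
        (diffAt_of (by norm_num) hS hs)).differentiableAt
    · refine (hMM x s hs p).trans ?_
      gcongr
  have h2 : ‖HamM H x m' p' - HamM H x m' p‖ ≤ Cb * K * ‖p' - p‖ := by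
    refine (convex_closedBall (0:Ed d) K).norm_image_sub_le_of_norm_fderiv_le
      (f := fun s => HamM H x m' s) (𝕜 := ℝ)
      (fun s hs => ?_) (fun s hs => ?_) (by simpa using hp) (by simpa using hp')
    · exact (partP (Φ := fun q : Ed d × ℝ × Ed d => HamM H q.1 q.2.1 q.2.2)
        (diffAt_of (by norm_num) hS hm')).differentiableAt
    · have e : ‖fderiv ℝ (fun s => HamM H x m' s) s‖ = ‖HamPM H x m' s‖ := by
        unfold HamPM
        rw [grad_eq]; simp
      rw [e]
      refine (hPM x m' hm' s).trans ?_
      gcongr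
      simpa using hs
  rw [Real.norm_eq_abs, Real.norm_eq_abs] at h1
  rw [Real.norm_eq_abs] at h2
  calc _ = |(HamM H x m' p' - HamM H x m' p) + (HamM H x m' p - HamM H x m p)| := by ring_nf
    _ ≤ _ := (abs_add_le _ _).trans (by linarith)

/-- composition with the solution: smoothness -/
lemma comp_smooth {F : Type*} [NormedAddCommGroup F] [NormedSpace ℝ F] {n : WithTop ℕ∞}
    (hn : 1 ≤ n) {Φ : Ed d × ℝ × Ed d → F}
    (h : ContDiffOn ℝ n Φ (Odom d)) {μ : Ed d → ℝ} {P : Ed d → Ed d} (hμ : ContDiff ℝ 1 μ)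
    (hP : ContDiff ℝ 1 P) (hpos : ∀ x, 0 < μ x) :
    ContDiff ℝ 1 (fun x => Φ (x, μ x, P x)) :=
  (h.of_le hn).comp_contDiff (contDiff_id.prodMk (hμ.prodMk hP)) fun x => hpos x

lemma B_lip {H : Ed d → ℝ → Ed d → ℝ}
    (hH : ContDiffOn ℝ 4 (fun q : Ed d × ℝ × Ed d => H q.1 q.2.1 q.2.2) (Odom d))
    {Cb K : ℝ} (hCb : 0 ≤ Cb)
    (hPX : ∀ x m, 0 < m → ∀ p, ‖fderiv ℝ (fun y => HamP H y m p) x‖ ≤ Cb * (‖p‖ + 1))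
    (hPM : ∀ x m, 0 < m → ∀ p, ‖HamPM H x m p‖ ≤ Cb * ‖p‖)
    (hPP : ∀ x m, 0 < m → ∀ p, ‖HamPP H x m p‖ ≤ Cb)
    {μ : Ed d → ℝ} {P : Ed d → Ed d} (hμ : ContDiff ℝ 1 μ)
    (hP : ContDiff ℝ 1 P) (hpos : ∀ x, 0 < μ x) (hK1 : ∀ x, ‖P x‖ ≤ K)
    (hK2 : ∀ x, ‖fderiv ℝ μ x‖ ≤ K) (hK3 : ∀ x, ‖fderiv ℝ P x‖ ≤ K) (x y : Ed d) :
    ‖HamP H x (μ x) (P x) - HamP H y (μ y) (P y)‖ ≤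
      (Cb * (K + 1) + Cb * K * K + Cb * K) * ‖x - y‖ := by
  have hK : 0 ≤ K := (norm_nonneg _).trans (hK1 0)
  refine (convex_univ (𝕜 := ℝ) (E := Ed d)).norm_image_sub_le_of_norm_hasFDerivWithin_le
    (f := fun x => HamP H x (μ x) (P x))
    (f' := fun x => (fderiv ℝ (fun q : Ed d × ℝ × Ed d => HamP H q.1 q.2.1 q.2.2) (x, μ x, P x)).comp
      ((ContinuousLinearMap.id ℝ (Ed d)).prod ((fderiv ℝ μ x).prod (fderiv ℝ P x))))
    (𝕜 := ℝ) (fun z _ => ?_) (fun z _ => ?_) (mem_univ y) (mem_univ x)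
  · have h1 : HasFDerivAt (fun x => (x, μ x, P x))
      ((ContinuousLinearMap.id ℝ (Ed d)).prod ((fderiv ℝ μ z).prod (fderiv ℝ P z))) z :=
      (hasFDerivAt_id z).prodMk ((hμ.differentiable (by norm_num) z).hasFDerivAt.prodMk
        (hP.differentiable (by norm_num) z).hasFDerivAt)
    exact ((diffAt_of (by norm_num) (HamP_smooth hH) (hpos z)).hasFDerivAt.comp z h1).hasFDerivWithinAt
  · refine ContinuousLinearMap.opNorm_le_bound _ (by positivity) fun w => ?_
    refine (HamP_fderiv_bound hH (hpos z) w (fderiv ℝ P z w) (fderiv ℝ μ z w)).trans ?_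
    have a1 : ‖fderiv ℝ P z w‖ ≤ K * ‖w‖ := (ContinuousLinearMap.le_opNorm _ _).trans (mul_le_mul_of_nonneg_right (hK3 z) (norm_nonneg _))
    have a2 : |fderiv ℝ μ z w| ≤ K * ‖w‖ := (ContinuousLinearMap.le_opNorm _ _).trans (mul_le_mul_of_nonneg_right (hK2 z) (norm_nonneg _))
    have b1 := hPX z (μ z) (hpos z) (P z)
    have b2 := hPM z (μ z) (hpos z) (P z)
    have b3 := hPP z (μ z) (hpos z) (P z)
    have k1 := hK1 z
    calc _ ≤ (Cb * (K + 1)) * ‖w‖ + (Cb * K) * (K * ‖w‖) + Cb * (K * ‖w‖) := by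
          gcongr
          · exact b1.trans (by gcongr)
          · exact b2.trans (by gcongr)
      _ = _ := by ring

lemma partial2_per {g : Ed d → ℝ} (h : ZPeriodic g) (i j : Fin d) : ZPeriodic (partial2 g i j) := by
  intro x l
  have h1 : ∀ x, fderiv ℝ g (x + ebasis d l) = fderiv ℝ g x := fun x => by
    rw [← fderiv_comp_add_right]
    congr 1
    exact funext fun y => h y l
  unfold partial2
  rw [← fderiv_comp_add_right]
  simp only [h1]

lemma lap_per {g : Ed d → ℝ} (h : ZPeriodic g) : ZPeriodic (lap g) := fun x l =>
  Finset.sum_congr rfl fun i _ => partial2_per h i i x l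

lemma tderiv_per {T : ℝ} {w : ℝ → Ed d → ℝ} (h : ∀ t ∈ Icc (0:ℝ) T, ZPeriodic (w t))
    {t : ℝ} (ht : t ∈ Icc (0:ℝ) T) : ZPeriodic (tderiv T w t) := fun x l =>
  derivWithin_congr (fun s hs => h s hs x l) (h t ht x l)

lemma div_identity {v ρ μ vt ρt b ft : Ed d → ℝ} {B PM : Ed d → Ed d}
    {PP : Ed d → Ed d →L[ℝ] Ed d} (hv : ContDiff ℝ 2 v) (hρ : ContDiff ℝ 2 ρ)
    (hμ : ContDiff ℝ 2 μ) (hB : ContDiff ℝ 1 B) (hPM : ContDiff ℝ 1 PM) (hPP : ContDiff ℝ 1 PP)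
    (h1 : ∀ x, -vt x - lap v x + ⟪B x, sgrad v x⟫ + b x * ρ x = ft x * ρ x)
    (h2 : ∀ x, ρt x - lap ρ x - diverg (fun y => ρ y • B y) x -
      diverg (fun y => (μ y * ρ y) • PM y) x = diverg (fun y => μ y • PP y (sgrad v y)) x) :
    ContDiff ℝ 1 (fun x => (ρ x * v x) • B x + (v x • ((μ x * ρ x) • PM x + μ x • PP x (sgrad v x))
        + v x • sgrad ρ x - ρ x • sgrad v x)) ∧
    ∀ x, diverg (fun x => (ρ x * v x) • B x + (v x • ((μ x * ρ x) • PM x + μ x • PP x (sgrad v x))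
        + v x • sgrad ρ x - ρ x • sgrad v x)) x = (ρt x * v x + ρ x * vt x) +
        ((-b x + ft x) * ρ x ^ 2 + μ x * ⟪PM x, sgrad v x⟫ * ρ x +
          μ x * ⟪PP x (sgrad v x), sgrad v x⟫) := by
  have v1 : ContDiff ℝ 1 v := hv.of_le (by norm_num)
  have r1 : ContDiff ℝ 1 ρ := hρ.of_le (by norm_num)
  have m1 : ContDiff ℝ 1 μ := hμ.of_le (by norm_num)
  have gv := sgrad_contDiff hv
  have gr := sgrad_contDiff hρ
  have c1 : ContDiff ℝ 1 (fun y => ρ y • B y) := r1.smul hB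
  have c2 : ContDiff ℝ 1 (fun y => (μ y * ρ y) • PM y) := (m1.mul r1).smul hPM
  have c3 : ContDiff ℝ 1 (fun y => μ y • PP y (sgrad v y)) := m1.smul (hPP.clm_apply gv)
  have c4 : ContDiff ℝ 1 (fun y => ρ y • sgrad v y) := r1.smul gv
  have c12 := c1.add c2
  have c123 := c12.add c3
  have cF := c123.add gr
  have cvF : ContDiff ℝ 1 (fun x => v x • (ρ x • B x + (μ x * ρ x) • PM x +
        μ x • PP x (sgrad v x) + sgrad ρ x)) := v1.smul cF
  have e : (fun x => (ρ x * v x) • B x + (v x • ((μ x * ρ x) • PM x + μ x • PP x (sgrad v x))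
        + v x • sgrad ρ x - ρ x • sgrad v x)) = fun x => v x • (ρ x • B x + (μ x * ρ x) • PM x +
        μ x • PP x (sgrad v x) + sgrad ρ x) - ρ x • sgrad v x := by
    funext x
    rw [mul_comm (ρ x), mul_smul]
    module
  rw [e]
  refine ⟨cvF.sub c4, fun x => ?_⟩
  have dd : ∀ {G : Ed d → Ed d}, ContDiff ℝ 1 G → DifferentiableAt ℝ G x :=
    fun h => h.differentiable (by norm_num) x
  rw [diverg_sub (dd cvF) (dd c4), diverg_smul (v1.differentiable (by norm_num) x) (dd cF),
    diverg_add (dd c123) (dd gr), diverg_add (dd c12) (dd c3), diverg_add (dd c1) (dd c2),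
    diverg_smul (r1.differentiable (by norm_num) x) (dd gv), diverg_sgrad hv, diverg_sgrad hρ]
  have h1' := h1 x
  have h2' := h2 x
  simp only [inner_add_right, real_inner_smul_right]
  rw [real_inner_comm (B x), real_inner_comm (PM x), real_inner_comm (PP x (sgrad v x)),
    real_inner_comm (sgrad v x) (sgrad ρ x)]
  rw [← h2']
  linear_combination (ρ x) * h1'

/-- lower bound of the quadratic form near the lattice orbit of a critical point -/
lemma crit_lower {H : Ed d → ℝ → Ed d → ℝ}
    (hH : ContDiffOn ℝ 4 (fun q : Ed d × ℝ × Ed d => H q.1 q.2.1 q.2.2) (Odom d))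
    {Cb K : ℝ} (hCb : 0 ≤ Cb) (hK : 0 ≤ K)
    (hPM : ∀ x m, 0 < m → ∀ p, ‖HamPM H x m p‖ ≤ Cb * ‖p‖)
    (hMM : ∀ x m, 0 < m → ∀ p, |HamMM H x m p| ≤ Cb * ‖p‖ ^ 2)
    (hXX : ∀ x m, 0 < m → ∀ p, ‖iteratedFDeriv ℝ 2 (fun y => HamM H y m p) x‖ ≤
      Cb * (‖p‖ ^ 2 + 1))
    (hform : ∀ (x : Ed d) (m : ℝ), 0 < m → ∀ p : Ed d, ∀ (r : ℝ) (q : Ed d),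
      ¬(r = 0 ∧ q = 0) →
      0 < -HamM H x m p * r ^ 2 + m * ⟪HamPM H x m p, q⟫ * r + m * ⟪HamPP H x m p q, q⟫)
    {μ ρ ft : Ed d → ℝ} {P q : Ed d → Ed d} (hpos : ∀ x, 0 < μ x) (hft : ∀ x, 0 ≤ ft x)
    (bμ : ∀ x, |μ x| ≤ K) (bρ : ∀ x, |ρ x| ≤ K) (bP : ∀ x, ‖P x‖ ≤ K)
    (lμ : ∀ x y, |μ x - μ y| ≤ K * ‖x - y‖) (lρ : ∀ x y, |ρ x - ρ y| ≤ K * ‖x - y‖)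
    (lP : ∀ x y, ‖P x - P y‖ ≤ K * ‖x - y‖) (lq : ∀ x y, ‖q x - q y‖ ≤ K * ‖x - y‖)
    (xs : Ed d) (hq0 : q xs = 0) (hρ0 : ρ xs ≠ 0)
    (pμ : ∀ k ∈ lat d, μ (xs + k) = μ xs) (pρ : ∀ k ∈ lat d, ρ (xs + k) = ρ xs)
    (pP : ∀ k ∈ lat d, P (xs + k) = P xs) (pq : ∀ k ∈ lat d, q (xs + k) = q xs)
    (pb : ∀ k ∈ lat d, HamM H (xs + k) (μ (xs + k)) (P (xs + k)) = HamM H xs (μ xs) (P xs)) :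
    ∃ δ > 0, ∃ r > 0, ∀ k ∈ lat d, ∀ y : Ed d, ‖y‖ < r →
      δ ≤ (-HamM H (xs + k + y) (μ (xs + k + y)) (P (xs + k + y)) + ft (xs + k + y)) *
        ρ (xs + k + y) ^ 2 + μ (xs + k + y) *
        ⟪HamPM H (xs + k + y) (μ (xs + k + y)) (P (xs + k + y)), q (xs + k + y)⟫ *
        ρ (xs + k + y) + μ (xs + k + y) *
        ⟪HamPP H (xs + k + y) (μ (xs + k + y)) (P (xs + k + y)) (q (xs + k + y)),
          q (xs + k + y)⟫ := by
  have hneg : ∀ x m, 0 < m → ∀ p, 0 < -HamM H x m p := by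
    intro x m hm p
    have := hform x m hm p 1 0 (by simp)
    simpa using this
  set β := -HamM H xs (μ xs) (P xs) with hβ
  have hβ0 : 0 < β := hneg _ _ (hpos xs) _
  set C := Cb * (K ^ 2 + 1) with hC
  have hC0 : 0 ≤ C := by positivity
  set D := β + C / 2 + (Cb * K ^ 2 * K + Cb * K * K) with hD
  have hD0 : 0 < D := by positivity
  have hr0 : 0 < |ρ xs| := abs_pos.mpr hρ0
  set N := Cb * K ^ 4 with hN
  have hN0 : 0 ≤ N := by positivity
  set R := |ρ xs| with hR
  refine ⟨β * R ^ 2 / 16, by positivity,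
    min (min 1 (β / (2 * D))) (min (R / (2 * (K + 1))) (β * R ^ 2 / (16 * (N + 1)))),
    by positivity, fun k hk y hy => ?_⟩
  obtain ⟨⟨hy1, hy2⟩, hy3, hy4⟩ := by simpa only [lt_min_iff] using hy
  rw [lt_div_iff₀ (by positivity)] at hy2 hy3 hy4
  set z := xs + k with hz
  set Y := ‖y‖ with hY
  have hY0 : 0 ≤ Y := norm_nonneg y
  have hzy : ‖z + y - z‖ = Y := by rw [add_sub_cancel_left]
  -- the H_m part
  have hsemi := semi_bound (ψ := fun x => -HamM H x (μ xs) (P xs)) (C := C) (by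
      have h3 : ContDiff ℝ 3 (fun x => HamM H x (μ xs) (P xs)) :=
        (HamM_smooth hH).comp_contDiff (contDiff_id.prodMk (contDiff_const (c := (μ xs, P xs)))) fun x => hpos xs
      exact (h3.of_le (by norm_num)).neg) (fun x => (hneg x _ (hpos xs) _).le) (fun x => by
      have : iteratedFDeriv ℝ 2 (fun x => -HamM H x (μ xs) (P xs)) x =
        - iteratedFDeriv ℝ 2 (fun x => HamM H x (μ xs) (P xs)) x := iteratedFDeriv_neg_apply
      rw [this, norm_neg]
      refine (hXX x _ (hpos xs) _).trans ?_
      have := bP xs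
      rw [hC]
      gcongr) z y hy1.le
  have hbz : -HamM H z (μ xs) (P xs) = β := by
    have := pb k hk
    rw [pμ k hk, pP k hk] at this
    rw [this]
  simp only [hbz] at hsemi
  have hvar := HamM_var hH hCb hPM hMM (z + y) (hpos xs) (hpos (z + y)) (bP xs) (bP (z + y))
  have t1 : |μ (z + y) - μ xs| ≤ K * Y := by
    have := lμ (z + y) z
    rwa [pμ k hk, hzy] at this
  have t2 : ‖P (z + y) - P xs‖ ≤ K * Y := by
    have := lP (z + y) z
    rwa [pP k hk, hzy] at this
  have t3 : |ρ (z + y) - ρ xs| ≤ K * Y := by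
    have := lρ (z + y) z
    rwa [pρ k hk, hzy] at this
  have t4 : ‖q (z + y)‖ ≤ K * Y := by
    have := lq (z + y) z
    rwa [pq k hk, hq0, sub_zero, hzy] at this
  have hvar' : |HamM H (z + y) (μ (z + y)) (P (z + y)) - HamM H (z + y) (μ xs) (P xs)| ≤
      (Cb * K ^ 2 * K + Cb * K * K) * Y := by
    refine hvar.trans ?_
    calc _ ≤ Cb * K ^ 2 * (K * Y) + Cb * K * (K * Y) := by gcongr
      _ = _ := by ring
  have hA : β / 2 ≤ -HamM H (z + y) (μ (z + y)) (P (z + y)) := by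
    have := (abs_le.mp hvar').2
    have : D * Y ≤ β / 2 := by linarith
    rw [hD] at this
    linarith only [this, hvar', hsemi, (abs_le.mp hvar').2]
  have hρy : R / 2 ≤ |ρ (z + y)| := by
    have a1 : |ρ xs| - |ρ (z + y)| ≤ |ρ (z + y) - ρ xs| := by
      rw [abs_sub_comm]; exact abs_sub_abs_le_abs_sub _ _
    have : K * Y ≤ R / 2 := by linarith only [hy3, hY0]
    linarith
  have hρ2 : R ^ 2 / 4 ≤ ρ (z + y) ^ 2 := by
    rw [← sq_abs (ρ (z + y))]
    have := pow_le_pow_left₀ (by positivity) hρy 2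
    linarith only [this]
  have hmain : β * R ^ 2 / 8 ≤
      (-HamM H (z + y) (μ (z + y)) (P (z + y)) + ft (z + y)) * ρ (z + y) ^ 2 := by
    have h5 : β / 2 * (R ^ 2 / 4) ≤
      (-HamM H (z + y) (μ (z + y)) (P (z + y)) + ft (z + y)) * ρ (z + y) ^ 2 := by
      have := hft (z + y)
      refine mul_le_mul (by linarith) hρ2 (by positivity) (by linarith)
    linarith
  have hcross : |μ (z + y) * ⟪HamPM H (z + y) (μ (z + y)) (P (z + y)), q (z + y)⟫ * ρ (z + y)| ≤
      N * Y := by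
    rw [abs_mul, abs_mul]
    have i1 : |⟪HamPM H (z + y) (μ (z + y)) (P (z + y)), q (z + y)⟫| ≤ (Cb * K) * (K * Y) := by
      refine (abs_real_inner_le_norm _ _).trans ?_
      refine mul_le_mul ((hPM _ _ (hpos _) _).trans ?_) t4 (norm_nonneg _) (by positivity)
      exact mul_le_mul_of_nonneg_left (bP _) hCb
    calc _ ≤ K * ((Cb * K) * (K * Y)) * K := by
          refine mul_le_mul (mul_le_mul (bμ _) i1 (abs_nonneg _) hK) (bρ _) (abs_nonneg _)
            (by positivity)
      _ = _ := by rw [hN]; ring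
  have hNY : N * Y ≤ β * R ^ 2 / 16 := by linarith only [hy4, hY0]
  have hPPn : 0 ≤ μ (z + y) * ⟪HamPP H (z + y) (μ (z + y)) (P (z + y)) (q (z + y)), q (z + y)⟫ := by
    by_cases hqz : q (z + y) = 0
    · simp [hqz]
    · have := hform (z + y) (μ (z + y)) (hpos (z + y)) (P (z + y)) 0 (q (z + y)) (by simp [hqz])
      simpa using this.le
  have := (abs_le.mp hcross).1
  linarith only [this, hPPn, hNY, hmain]

/-- the lattice orbit of a ball -/
def orb (xs : Ed d) (r : ℝ) : Set (Ed d) := {x | ∃ k ∈ lat d, ‖x - xs - k‖ < r}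

lemma orb_open (xs : Ed d) (r : ℝ) : IsOpen (orb xs r) := by
  have : orb xs r = ⋃ k ∈ lat d, {x | ‖x - xs - k‖ < r} := by
    ext x; simp [orb]
  rw [this]
  exact isOpen_biUnion fun k _ => isOpen_lt (by fun_prop) continuous_const

lemma orb_add (xs : Ed d) (r : ℝ) {l : Ed d} (hl : l ∈ lat d) (x : Ed d) :
    x + l ∈ orb xs r ↔ x ∈ orb xs r := by
  constructor
  · rintro ⟨k, hk, h⟩
    refine ⟨k - l, sub_mem hk hl, ?_⟩
    convert h using 2
    abel
  · rintro ⟨k, hk, h⟩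
    refine ⟨k + l, add_mem hk hl, ?_⟩
    convert h using 2
    abel

lemma orb_pos (xs : Ed d) {r : ℝ} (hr : 0 < r) : volume (orb xs r ∩ cube d) ≠ 0 := by
  intro h0
  have := lat_inv (d := d)
  have h1 : volume (orb xs r) = 0 := by
    refine (cube_fd (d := d)).measure_zero_of_invariant _ (fun g => ?_) h0
    ext x
    rw [Set.mem_vadd_set_iff_neg_vadd_mem]
    have : (-g +ᵥ x : Ed d) = x + (-(g : Ed d)) := by
      rw [add_comm]; rfl
    rw [this]
    exact orb_add xs r (neg_mem g.2) x
  have h2 : (orb xs r).Nonempty := ⟨xs, 0, zero_mem _, by simpa using hr⟩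
  exact ((orb_open xs r).measure_pos volume h2).ne' h1

lemma ebasis_mem (i : Fin d) : ebasis d i ∈ lat d := by
  refine Submodule.subset_span ⟨i, ?_⟩
  simp [ebasis]

lemma orb_int (xs : Ed d) {r δ : ℝ} (hr : 0 < r) (hδ : 0 < δ) :
    ZPeriodic ((orb xs r).indicator fun _ => δ) ∧ Measurable ((orb xs r).indicator fun _ => δ) ∧
    0 < ∫ x in cube d, (orb xs r).indicator (fun _ => δ) x := by
  have hmeas := (orb_open xs r).measurableSet
  refine ⟨fun x i => ?_, measurable_const.indicator hmeas, ?_⟩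
  · have := orb_add xs r (ebasis_mem i) x
    by_cases h : x ∈ orb xs r
    · rw [indicator_of_mem h, indicator_of_mem (this.mpr h)]
    · rw [indicator_of_notMem h, indicator_of_notMem (fun h' => h (this.mp h'))]
  · rw [setIntegral_indicator hmeas, setIntegral_const, smul_eq_mul]
    refine mul_pos ?_ hδ
    rw [Measure.real, ENNReal.toReal_pos_iff, inter_comm]
    refine ⟨pos_iff_ne_zero.mpr (orb_pos xs hr), (measure_mono inter_subset_right).trans_lt ?_⟩
    rw [cube_vol]; simp

lemma lip_of_fderiv {F : Type*} [NormedAddCommGroup F] [NormedSpace ℝ F] {g : Ed d → F} {K : ℝ}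
    (hg : ContDiff ℝ 1 g) (hK : ∀ x, ‖fderiv ℝ g x‖ ≤ K) (x y : Ed d) :
    ‖g x - g y‖ ≤ K * ‖x - y‖ :=
  (convex_univ (𝕜 := ℝ) (E := Ed d)).norm_image_sub_le_of_norm_fderiv_le (𝕜 := ℝ)
    (fun z _ => hg.differentiable (by norm_num) z) (fun z _ => hK z) (mem_univ y) (mem_univ x)

lemma norm_sgrad (f : Ed d → ℝ) (x : Ed d) : ‖sgrad f x‖ = ‖fderiv ℝ f x‖ := by
  unfold sgrad
  rw [grad_eq]; simp

lemma tderiv_cont {T a : ℝ} (ha : 0 < a) {w : ℝ → Ed d → ℝ} (h : InC2alpha T a w) {t : ℝ}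
    (ht : t ∈ Icc (0:ℝ) T) : Continuous (tderiv T w t) := by
  have h1 := holder_cont ha h.2.2.2.2.2.2
  rw [← continuousOn_univ]
  exact h1.comp (f := fun x : Ed d => (t, x)) (by fun_prop) fun x _ => ⟨ht, mem_univ x⟩

lemma tderiv_hasDerivAt {T a : ℝ} {w : ℝ → Ed d → ℝ} (h : InC2alpha T a w) {t : ℝ}
    (ht : t ∈ Ioo (0:ℝ) T) (x : Ed d) : HasDerivAt (fun s => w s x) (tderiv T w t x) t :=
  ((h.2.2.1 x t (Ioo_subset_Icc_self ht)).hasDerivWithinAt).hasDerivAt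
    (Icc_mem_nhds ht.1 ht.2)

/-- the energy `∫ ρ v` -/
lemma energy {T a : ℝ} (ha : 0 < a) {v ρ : ℝ → Ed d → ℝ} (hv : InC2alpha T a v)
    (hρ : InC2alpha T a ρ) :
    ContinuousOn (fun t => ∫ x in cube d, ρ t x * v t x) (Icc 0 T) ∧
    ∀ t ∈ Ioo (0:ℝ) T, HasDerivAt (fun t => ∫ x in cube d, ρ t x * v t x)
      (∫ x in cube d, (tderiv T ρ t x * v t x + ρ t x * tderiv T v t x)) t := by
  obtain ⟨K1, hK1, b1⟩ := reg_bounds hv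
  obtain ⟨K2, hK2, b2⟩ := reg_bounds hρ
  have cv : ∀ t ∈ Icc (0:ℝ) T, Continuous (v t) := fun t ht => (hv.2.1 t ht).continuous
  have cr : ∀ t ∈ Icc (0:ℝ) T, Continuous (ρ t) := fun t ht => (hρ.2.1 t ht).continuous
  have hfin : IsFiniteMeasure (volume.restrict (cube d)) := by
    refine ⟨?_⟩
    rw [Measure.restrict_apply_univ, cube_vol]; simp
  have bd : ∀ t ∈ Icc (0:ℝ) T, ∀ x, ‖ρ t x * v t x‖ ≤ K2 * K1 := fun t ht x => by
    rw [norm_mul]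
    exact mul_le_mul (b2 t ht x).1 (b1 t ht x).1 (norm_nonneg _) hK2
  have hmeas : ∀ t ∈ Icc (0:ℝ) T,
      AEStronglyMeasurable (fun x => ρ t x * v t x) (volume.restrict (cube d)) :=
    fun t ht => ((cr t ht).mul (cv t ht)).aestronglyMeasurable
  refine ⟨?_, fun t ht => ?_⟩
  · exact continuousOn_of_dominated (bound := fun _ => K2 * K1) hmeas
      (fun t ht => Filter.Eventually.of_forall (bd t ht)) (integrable_const _)
      (Filter.Eventually.of_forall fun x =>
        (hρ.2.2.1 x).continuousOn.mul (hv.2.2.1 x).continuousOn)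
  · have hI := Ioo_subset_Icc_self ht
    refine (hasDerivAt_integral_of_dominated_loc_of_deriv_le
      (bound := fun _ => K2 * K1 + K2 * K1) (s := Ioo 0 T) (F := fun t x => ρ t x * v t x)
      (F' := fun t x => tderiv T ρ t x * v t x + ρ t x * tderiv T v t x)
      (Ioo_mem_nhds ht.1 ht.2) ?_ ?_ ?_ ?_ (integrable_const _) ?_).2
    · filter_upwards [Ioo_mem_nhds ht.1 ht.2] with s hs using hmeas s (Ioo_subset_Icc_self hs)
    · exact Integrable.of_bound (hmeas t hI) _ (Filter.Eventually.of_forall (bd t hI))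
    · exact (((tderiv_cont ha hρ hI).mul (cv t hI)).add
        ((cr t hI).mul (tderiv_cont ha hv hI))).aestronglyMeasurable
    · refine Filter.Eventually.of_forall fun x s hs => ?_
      have hs' := Ioo_subset_Icc_self hs
      refine (norm_add_le _ _).trans (add_le_add ?_ ?_)
      · rw [norm_mul]
        exact mul_le_mul (b2 s hs' x).2.2.2 (b1 s hs' x).1 (norm_nonneg _) hK2
      · rw [norm_mul]
        exact mul_le_mul (b2 s hs' x).1 (b1 s hs' x).2.2.2 (norm_nonneg _) hK2
    · exact Filter.Eventually.of_forall fun x s hs =>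
        (tderiv_hasDerivAt hρ hs x).mul (tderiv_hasDerivAt hv hs x)

lemma sgrad_neg (f : Ed d → ℝ) (x : Ed d) : sgrad (fun y => -f y) x = -sgrad f x := by
  unfold sgrad
  rw [grad_eq, grad_eq, fderiv_fun_neg, map_neg]

lemma lap_neg (f : Ed d → ℝ) (x : Ed d) : lap (fun y => -f y) x = -lap f x := by
  unfold lap partial2
  rw [← Finset.sum_neg_distrib]
  refine Finset.sum_congr rfl fun i _ => ?_
  simp [fderiv_fun_neg]

lemma tderiv_neg (T : ℝ) (w : ℝ → Ed d → ℝ) (t : ℝ) (x : Ed d) :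
    tderiv T (fun s y => -w s y) t x = -tderiv T w t x := by
  unfold tderiv
  exact derivWithin.fun_neg

/-- Lemma `stable`: let `(u,m)` be the classical solution of the
MFG system (with `m > 0` on `Q`). Then any classical solution `(v,ρ)` of the
linearized system
(i)  `-∂ₜv - Δv + H_p(x,m,Du)·Dv + H_m(x,m,Du)ρ = f'(m)ρ`;
(ii) `∂ₜρ - Δρ - div(ρH_p(x,m,Du)) - div(mρH_pm(x,m,Du))
        = div(mH_pp(x,m,Du)Dv)`;
with `ρ(·,0) = 0`, `v(·,T) = 0`, is the trivial solution `(v,ρ) = (0,0)`. -/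
theorem linearized_mfg_uniqueness
    (d : ℕ) (hd : 1 ≤ d) (T α ϑ : ℝ) (hT : 0 < T) (hα : α ∈ Ioo (0:ℝ) 1)
    (hϑ : 0 < ϑ) (H : Ed d → ℝ → Ed d → ℝ) (f : ℝ → ℝ) (m0 uT : Ed d → ℝ)
    (hA1 : A1 α ϑ m0 uT) (hA2 : A2 H) (hA3 : A3 f)
    (u m : ℝ → Ed d → ℝ) (hu : InC2alpha T α u) (hm : InC2alpha T α m)
    (hsol : SolvesMFG T H f m0 uT u m)
    (hmpos : ∀ t ∈ Icc (0:ℝ) T, ∀ x : Ed d, 0 < m t x)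
    (v ρ : ℝ → Ed d → ℝ) (hv : InC2alpha T α v) (hρ : InC2alpha T α ρ)
    (heq1 : ∀ t ∈ Icc (0:ℝ) T, ∀ x : Ed d,
      -tderiv T v t x - lap (v t) x +
          ⟪HamP H x (m t x) (sgrad (u t) x), sgrad (v t) x⟫ +
          HamM H x (m t x) (sgrad (u t) x) * ρ t x =
        deriv f (m t x) * ρ t x)
    (heq2 : ∀ t ∈ Icc (0:ℝ) T, ∀ x : Ed d,
      tderiv T ρ t x - lap (ρ t) x -
          diverg (fun y => ρ t y • HamP H y (m t y) (sgrad (u t) y)) x -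
          diverg (fun y =>
            (m t y * ρ t y) • HamPM H y (m t y) (sgrad (u t) y)) x =
        diverg (fun y =>
          m t y • HamPP H y (m t y) (sgrad (u t) y) (sgrad (v t) y)) x)
    (hinit : ∀ x : Ed d, ρ 0 x = 0) (hterm : ∀ x : Ed d, v T x = 0) :
    ∀ t ∈ Icc (0:ℝ) T, ∀ x : Ed d, v t x = 0 ∧ ρ t x = 0 := by
  obtain ⟨hα0, -⟩ := hα
  obtain ⟨hH, ⟨Cb, hCb, hb⟩, hform⟩ := hA2
  obtain ⟨-, -, hf'⟩ := hA3
  obtain ⟨Ku, hKu, bu⟩ := reg_bounds hu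
  obtain ⟨Km, hKm, bm⟩ := reg_bounds hm
  obtain ⟨Kv, hKv, bv⟩ := reg_bounds hv
  obtain ⟨Kr, hKr, br⟩ := reg_bounds hρ
  set K := Ku + Km + Kv + Kr with hKdef
  have hK : 0 ≤ K := by positivity
  have hPX : ∀ x m, 0 < m → ∀ p, ‖fderiv ℝ (fun y => HamP H y m p) x‖ ≤ Cb * (‖p‖ + 1) :=
    fun x m h p => (hb x m h p).1
  have hXX : ∀ x m, 0 < m → ∀ p, ‖iteratedFDeriv ℝ 2 (fun y => HamM H y m p) x‖ ≤
      Cb * (‖p‖ ^ 2 + 1) := fun x m h p =>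
    (le_add_of_nonneg_left (norm_nonneg _)).trans (hb x m h p).2.1
  have hPM : ∀ x m, 0 < m → ∀ p, ‖HamPM H x m p‖ ≤ Cb * ‖p‖ := fun x m h p => (hb x m h p).2.2.1
  have hMM : ∀ x m, 0 < m → ∀ p, |HamMM H x m p| ≤ Cb * ‖p‖ ^ 2 :=
    fun x m h p => (hb x m h p).2.2.2.1
  have hPP : ∀ x m, 0 < m → ∀ p, ‖HamPP H x m p‖ ≤ Cb := fun x m h p =>
    (le_add_of_nonneg_right (norm_nonneg _)).trans (hb x m h p).2.2.2.2.1
  -- uniform bounds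
  have bu' : ∀ t ∈ Icc (0:ℝ) T, ∀ x, ‖sgrad (u t) x‖ ≤ K ∧ ‖fderiv ℝ (sgrad (u t)) x‖ ≤ K :=
    fun t ht x => ⟨(bu t ht x).2.1.trans (by linarith), (bu t ht x).2.2.1.trans (by linarith)⟩
  have bm' : ∀ t ∈ Icc (0:ℝ) T, ∀ x, |m t x| ≤ K ∧ ‖sgrad (m t) x‖ ≤ K :=
    fun t ht x => ⟨(bm t ht x).1.trans (by linarith), (bm t ht x).2.1.trans (by linarith)⟩
  have bv' : ∀ t ∈ Icc (0:ℝ) T, ∀ x, |v t x| ≤ K ∧ ‖sgrad (v t) x‖ ≤ K ∧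
      ‖fderiv ℝ (sgrad (v t)) x‖ ≤ K ∧ |tderiv T v t x| ≤ K :=
    fun t ht x => ⟨(bv t ht x).1.trans (by linarith), (bv t ht x).2.1.trans (by linarith),
      (bv t ht x).2.2.1.trans (by linarith), (bv t ht x).2.2.2.trans (by linarith)⟩
  have br' : ∀ t ∈ Icc (0:ℝ) T, ∀ x, |ρ t x| ≤ K ∧ ‖sgrad (ρ t) x‖ ≤ K ∧
      |tderiv T ρ t x| ≤ K :=
    fun t ht x => ⟨(br t ht x).1.trans (by linarith), (br t ht x).2.1.trans (by linarith),
      (br t ht x).2.2.2.trans (by linarith)⟩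
  clear_value K
  obtain ⟨C1, hC1, hfix⟩ := fixed_time d
  set L := Cb * (K + 1) + Cb * K * K + Cb * K with hL
  have hL0 : 0 ≤ L := by positivity
  set Ψ : ℝ → Ed d → ℝ := fun t x =>
    (-HamM H x (m t x) (sgrad (u t) x) + deriv f (m t x)) * ρ t x ^ 2 +
      m t x * ⟪HamPM H x (m t x) (sgrad (u t) x), sgrad (v t) x⟫ * ρ t x +
      m t x * ⟪HamPP H x (m t x) (sgrad (u t) x) (sgrad (v t) x), sgrad (v t) x⟫ with hΨ
  have hΨ0 : ∀ t ∈ Icc (0:ℝ) T, ∀ x, 0 ≤ Ψ t x := by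
    intro t ht x
    have h1 : 0 ≤ deriv f (m t x) * ρ t x ^ 2 := mul_nonneg (hf' _ (hmpos t ht x)) (sq_nonneg _)
    have h2 : 0 ≤ -HamM H x (m t x) (sgrad (u t) x) * ρ t x ^ 2 +
      m t x * ⟪HamPM H x (m t x) (sgrad (u t) x), sgrad (v t) x⟫ * ρ t x +
      m t x * ⟪HamPP H x (m t x) (sgrad (u t) x) (sgrad (v t) x), sgrad (v t) x⟫ := by
      by_cases hz : ρ t x = 0 ∧ sgrad (v t) x = 0
      · rw [hz.1, hz.2]; simp
      · exact (hform x _ (hmpos t ht x) _ _ _ hz).le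
    simp only [hΨ]
    linarith
  -- energy inequality at a fixed time
  have hineq : ∀ t ∈ Icc (0:ℝ) T, ∀ (χ : Ed d → ℝ) (M0 : ℝ), ZPeriodic χ → Measurable χ →
      (∀ x, |χ x| ≤ M0) → (∀ x, χ x ≤ Ψ t x) →
      (∫ x in cube d, (tderiv T ρ t x * v t x + ρ t x * tderiv T v t x)) +
        (∫ x in cube d, χ x) ≤ C1 * L * |∫ x in cube d, ρ t x * v t x| := by
    intro t ht χ M0 pχ mχ bχ hχ
    have v2 := hv.2.1 t ht
    have r2 := hρ.2.1 t ht
    have m2 := hm.2.1 t ht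
    have u2 := hu.2.1 t ht
    have m1 : ContDiff ℝ 1 (m t) := m2.of_le (by norm_num)
    have gu := sgrad_contDiff u2
    have hposT := hmpos t ht
    have hB := comp_smooth (by norm_num) (HamP_smooth hH) m1 gu hposT
    have hPMs := comp_smooth (by norm_num) (HamPM_smooth hH) m1 gu hposT
    have hPPs := comp_smooth (by norm_num) (HamPP_smooth hH) m1 gu hposT
    obtain ⟨hWc, hWd⟩ := div_identity (vt := tderiv T v t) (ρt := tderiv T ρ t)
      (b := fun x => HamM H x (m t x) (sgrad (u t) x)) (ft := fun x => deriv f (m t x))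
      v2 r2 m2 hB hPMs hPPs (heq1 t ht) (heq2 t ht)
    have hM0 : 0 ≤ M0 := (abs_nonneg _).trans (bχ 0)
    have pv := hv.1 t ht
    have pr := hρ.1 t ht
    have ptv := tderiv_per hv.1 ht
    have ptr := tderiv_per hρ.1 ht
    refine hfix (fun x => ρ t x * v t x)
      (fun x => tderiv T ρ t x * v t x + ρ t x * tderiv T v t x) χ (Ψ t)
      (fun x => HamP H x (m t x) (sgrad (u t) x)) _ L
      (M0 + (K * K + K * K) + (K * (K * K * (Cb * K) + K * (Cb * K)) + K * K + K * K)) hL0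
      ?_ ?_ ?_ pχ ?_ ?_ mχ ?_ ?_ ?_ ?_ hWc hWd hχ
    · exact B_lip hH hCb.le hPX hPM hPP m1 gu hposT (fun x => (bu' t ht x).1)
        (fun x => by rw [← norm_sgrad]; exact (bm' t ht x).2) (fun x => (bu' t ht x).2)
    · intro x i
      simp only [pv x i, pr x i]
    · intro x i
      simp only [pv x i, pr x i, ptv x i, ptr x i]
    · exact (r2.continuous.mul v2.continuous).measurable
    · exact (((tderiv_cont hα0 hρ ht).mul v2.continuous).add
        (r2.continuous.mul (tderiv_cont hα0 hv ht))).measurable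
    · intro x
      have : |ρ t x * v t x| ≤ K * K := by
        rw [abs_mul]
        exact mul_le_mul (br' t ht x).1 (bv' t ht x).1 (abs_nonneg _) hK
      refine this.trans ?_
      have : 0 ≤ K * K := by positivity
      have : 0 ≤ K * (K * K * (Cb * K) + K * (Cb * K)) := by positivity
      linarith
    · intro x
      have h1 : |tderiv T ρ t x * v t x| ≤ K * K := by
        rw [abs_mul]
        exact mul_le_mul (br' t ht x).2.2 (bv' t ht x).1 (abs_nonneg _) hK
      have h2 : |ρ t x * tderiv T v t x| ≤ K * K := by
        rw [abs_mul]
        exact mul_le_mul (br' t ht x).1 (bv' t ht x).2.2.2 (abs_nonneg _) hK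
      refine (abs_add_le _ _).trans ?_
      have : 0 ≤ K * K := by positivity
      have : 0 ≤ K * (K * K * (Cb * K) + K * (Cb * K)) := by positivity
      linarith
    · intro x
      refine (bχ x).trans ?_
      have : 0 ≤ K * K := by positivity
      have : 0 ≤ K * (K * K * (Cb * K) + K * (Cb * K)) := by positivity
      linarith
    · intro x
      have k1 : ‖v t x‖ ≤ K := (bv' t ht x).1
      have k2 : ‖ρ t x‖ ≤ K := (br' t ht x).1
      have k3 : ‖m t x‖ ≤ K := (bm' t ht x).1
      have k4 := (bv' t ht x).2.1
      have k5 := (br' t ht x).2.1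
      have k6 : ‖HamPM H x (m t x) (sgrad (u t) x)‖ ≤ Cb * K := (hPM x _ (hposT x) _).trans
        (mul_le_mul_of_nonneg_left (bu' t ht x).1 hCb.le)
      have k7 : ‖HamPP H x (m t x) (sgrad (u t) x) (sgrad (v t) x)‖ ≤ Cb * K :=
        (ContinuousLinearMap.le_opNorm _ _).trans
          (mul_le_mul (hPP x _ (hposT x) _) k4 (norm_nonneg _) hCb.le)
      have sm : ∀ {c : ℝ} {w : Ed d} {a b : ℝ}, ‖c‖ ≤ a → ‖w‖ ≤ b → ‖c • w‖ ≤ a * b := by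
        intro c w a b h1 h2
        rw [norm_smul]
        exact mul_le_mul h1 h2 (norm_nonneg _) ((norm_nonneg _).trans h1)
      have k8 : ‖m t x * ρ t x‖ ≤ K * K := by
        rw [norm_mul]; exact mul_le_mul k3 k2 (norm_nonneg _) hK
      have hW : ‖v t x • ((m t x * ρ t x) • HamPM H x (m t x) (sgrad (u t) x) +
          m t x • HamPP H x (m t x) (sgrad (u t) x) (sgrad (v t) x)) + v t x • sgrad (ρ t) x -
          ρ t x • sgrad (v t) x‖ ≤ K * (K * K * (Cb * K) + K * (Cb * K)) + K * K + K * K := by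
        refine (norm_sub_le _ _).trans (add_le_add ((norm_add_le _ _).trans
          (add_le_add (sm k1 ((norm_add_le _ _).trans (add_le_add (sm k8 k6) (sm k3 k7))))
          (sm k1 k5))) (sm k2 k4))
      refine hW.trans ?_
      have : 0 ≤ K * K := by positivity
      linarith
  -- the energy vanishes
  obtain ⟨hEc, hEd⟩ := energy hα0 hv hρ
  have hE0 : ∀ t ∈ Ioo (0:ℝ) T, ∫ x in cube d, ρ t x * v t x = 0 := by
    refine ode_zero (E := fun t => ∫ x in cube d, ρ t x * v t x) (C := C1 * L)
      (by positivity) hEc hEd (fun t ht => ?_) (by simp [hinit]) (by simp [hterm])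
    have := hineq t (Ioo_subset_Icc_self ht) (fun _ => 0) 0 (fun _ _ => rfl) measurable_const
      (by simp) (hΨ0 t (Ioo_subset_Icc_self ht))
    simpa using this
  have hE1 : ∀ t ∈ Ioo (0:ℝ) T,
      ∫ x in cube d, (tderiv T ρ t x * v t x + ρ t x * tderiv T v t x) = 0 := by
    intro t ht
    refine (hEd t ht).unique ?_
    refine (hasDerivAt_const t (0:ℝ)).congr_of_eventuallyEq ?_
    filter_upwards [Ioo_mem_nhds ht.1 ht.2] with s hs using hE0 s hs
  -- ρ vanishes at the critical points of v
  have hcrit : ∀ t ∈ Ioo (0:ℝ) T, ∀ x, sgrad (v t) x = 0 → ρ t x = 0 := by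
    intro t ht' xs hgrad
    by_contra hne
    have ht := Ioo_subset_Icc_self ht'
    have v2 := hv.2.1 t ht
    have r1 : ContDiff ℝ 1 (ρ t) := (hρ.2.1 t ht).of_le (by norm_num)
    have m1 : ContDiff ℝ 1 (m t) := (hm.2.1 t ht).of_le (by norm_num)
    have gu := sgrad_contDiff (hu.2.1 t ht)
    have pm : ∀ k ∈ lat d, m t (xs + k) = m t xs := fun k hk => per_lat (hm.1 t ht) hk xs
    have pr : ∀ k ∈ lat d, ρ t (xs + k) = ρ t xs := fun k hk => per_lat (hρ.1 t ht) hk xs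
    have pu : ∀ k ∈ lat d, sgrad (u t) (xs + k) = sgrad (u t) xs :=
      fun k hk => per_lat (sgrad_per (hu.1 t ht)) hk xs
    have pv : ∀ k ∈ lat d, sgrad (v t) (xs + k) = sgrad (v t) xs :=
      fun k hk => per_lat (sgrad_per (hv.1 t ht)) hk xs
    have pvt : ∀ k ∈ lat d, tderiv T v t (xs + k) = tderiv T v t xs :=
      fun k hk => per_lat (tderiv_per hv.1 ht) hk xs
    have pvl : ∀ k ∈ lat d, lap (v t) (xs + k) = lap (v t) xs :=
      fun k hk => per_lat (lap_per (hv.1 t ht)) hk xs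
    obtain ⟨δ, hδ, r, hr, hlow⟩ := crit_lower (q := sgrad (v t)) (ρ := ρ t)
      (ft := fun x => deriv f (m t x)) hH hCb.le hK hPM hMM hXX hform
      (hmpos t ht) (fun x => hf' _ (hmpos t ht x)) (fun x => (bm' t ht x).1)
      (fun x => (br' t ht x).1) (fun x => (bu' t ht x).1)
      (lip_of_fderiv m1 fun x => by rw [← norm_sgrad]; exact (bm' t ht x).2)
      (lip_of_fderiv r1 fun x => by rw [← norm_sgrad]; exact (br' t ht x).2.1)
      (lip_of_fderiv gu fun x => (bu' t ht x).2)
      (lip_of_fderiv (sgrad_contDiff v2) fun x => (bv' t ht x).2.2.1)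
      xs hgrad hne pm pr pu pv (fun k hk => by
        have e1 := heq1 t ht xs
        have e2 := heq1 t ht (xs + k)
        rw [pv k hk, pvt k hk, pvl k hk, pr k hk, pm k hk, pu k hk, hgrad, inner_zero_right] at e2
        rw [hgrad, inner_zero_right] at e1
        rw [pm k hk, pu k hk]
        refine mul_right_cancel₀ hne ?_
        linarith)
    obtain ⟨pχ, mχ, iχ⟩ := orb_int xs hr hδ
    have := hineq t ht _ δ pχ mχ (fun x => by
        by_cases h : x ∈ orb xs r
        · rw [indicator_of_mem h, abs_of_pos hδ]
        · rw [indicator_of_notMem h, abs_zero]; exact hδ.le) (fun x => by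
        by_cases h : x ∈ orb xs r
        · rw [indicator_of_mem h]
          obtain ⟨k, hk, hxk⟩ := h
          have := hlow k hk (x - xs - k) hxk
          have ex : xs + k + (x - xs - k) = x := by abel
          rw [ex] at this
          exact this
        · rw [indicator_of_notMem h]; exact hΨ0 t ht x)
    rw [hE0 t ht', hE1 t ht', abs_zero, mul_zero, zero_add] at this
    linarith
  -- maximum principle
  have hcrit' : ∀ t ∈ Ico (0:ℝ) T, ∀ x, sgrad (v t) x = 0 → tderiv T v t x = - lap (v t) x := by
    intro t ht x hx
    have hρx : ρ t x = 0 := by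
      rcases eq_or_lt_of_le ht.1 with h0 | h0
      · rw [← h0]; exact hinit x
      · exact hcrit t ⟨h0, ht.2⟩ x hx
    have := heq1 t (Ico_subset_Icc_self ht) x
    rw [hx, hρx, inner_zero_right] at this
    linarith
  have hvc := holder_cont hα0 hv.2.2.2.1
  have hv1 := max_principle hvc hv.1 hv.2.1 hv.2.2.1 hterm hcrit'
  have hv2 := max_principle (w := fun t x => -v t x) hvc.neg
    (fun t ht x i => by simp only [hv.1 t ht x i]) (fun t ht => (hv.2.1 t ht).neg)
    (fun x => (hv.2.2.1 x).neg) (fun x => by simp [hterm x]) (fun t ht x hx => by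
      rw [sgrad_neg, neg_eq_zero] at hx
      rw [tderiv_neg, lap_neg, hcrit' t ht x hx])
  have hv0 : ∀ t ∈ Icc (0:ℝ) T, ∀ x, v t x = 0 := fun t ht x =>
    le_antisymm (hv1 t ht x) (by have := hv2 t ht x; linarith)
  have hr0 : ∀ t ∈ Ioo (0:ℝ) T, ∀ x, ρ t x = 0 := by
    intro t ht x
    refine hcrit t ht x ?_
    have e : v t = fun _ => 0 := funext fun y => hv0 t (Ioo_subset_Icc_self ht) y
    rw [e]
    unfold sgrad
    simp [grad_eq]
  intro t ht x
  refine ⟨hv0 t ht x, ?_⟩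
  have hcl : t ∈ closure (Ioo (0:ℝ) T) := by rwa [closure_Ioo hT.ne]
  have hc : ContinuousOn (fun s => ρ s x) (Icc 0 T) := (hρ.2.2.1 x).continuousOn
  have h1 : Filter.Tendsto (fun s => ρ s x) (nhdsWithin t (Ioo 0 T)) (nhds (ρ t x)) :=
    (hc t ht).mono_left (nhdsWithin_mono t Ioo_subset_Icc_self)
  have h2 : Filter.Tendsto (fun s => ρ s x) (nhdsWithin t (Ioo 0 T)) (nhds 0) := by
    refine tendsto_const_nhds.congr' ?_
    filter_upwards [self_mem_nhdsWithin] with s hs using (hr0 s hs x).symm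
  have : (nhdsWithin t (Ioo (0:ℝ) T)).NeBot := mem_closure_iff_nhdsWithin_neBot.mp hcl
  exact tendsto_nhds_unique h1 h2
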